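/- arXiv:2006.06397 — 2 statements merged into one kernel-verified Lean document; each statement's English description precedes it below -/
import Mathlib

section
/- Let s be a positive integer, q_0 = 3^s, q = 3·q_0², m = q − 3q_0 + 1, and let F_{q⁶} be the finite field with q⁶ elements. Then the number of quadruples (a,b,c,d) ∈ F_{q⁶}⁴ satisfying b^q − b = a^{q_0}·(a^q − a), c^q − c = a^{2q_0}·(a^q − a), d^m = a^q − a, and d ≠ 0 equals q⁷ − q⁶ + q⁴ − q³. -/
/-- A vector space with the cross product, the invariant symmetric form and the semilinear
product on collinear pairs of the Ree hexagon. -/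
structure ReeHexagon (k V : Type*) [Field k] [AddCommGroup V] [Module k V] where
  B : V →ₗ[k] V →ₗ[k] k
  cr : V →ₗ[k] V →ₗ[k] V
  ζ : V → V → V
  τ : k ≃+* k
  C : k
  D : k
  two_ne : (2 : k) ≠ 0
  C_ne : C ≠ 0
  D_ne : D ≠ 0
  B_symm : ∀ x y, B x y = B y x
  cr_swap : ∀ x y, cr y x = -cr x y
  cr_cr : ∀ x y z, cr x (cr y z) + cr y (cr x z) = -(B x z • y) - B y z • x - B x y • z
  ζ_self : ∀ x, ζ x x = 0
  ζ_swap : ∀ x y, cr x y = 0 → ζ y x = -ζ x y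
  ζ_lin : ∀ x y y' a b, cr x y = 0 → cr x y' = 0 →
    ζ x (a • y + b • y') = τ a • ζ x y + τ b • ζ x y'
  ζ_eq_zero : ∀ x y, x ≠ 0 → cr x y = 0 → ζ x y = 0 → ∃ c : k, y = c • x
  triangle : ∀ x y z, x ≠ 0 → (¬ ∃ c : k, y = c • x) → cr x y = 0 → cr x z = 0 → cr y z = 0 →
    ∃ a b : k, z = a • x + b • y
  B_ζ_ζ : ∀ z w x y, cr z w = 0 → cr x y = 0 →
    B (ζ z w) (ζ x y) = D * τ (B z x * B w y - B z y * B w x)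
  cr_ζ_ζ : ∀ z w x y, cr z w = 0 → cr x y = 0 → cr z y = 0 → B z x = 0 → B w y = 0 →
    B z y = 0 → cr (ζ z w) (ζ x y) = (C * τ (B w x)) • ζ z y
  ζ_ζ_ζ : ∀ x y z, x ≠ 0 → B x x = 0 → cr x y = 0 → cr x z = 0 →
    ∃ c : k, ζ (ζ x y) (ζ x z) = c • x ∧ (c = 0 → (∃ a : k, y = a • x) ∨
      ∃ a b : k, z = a • x + b • y)
  seven_le : 7 ≤ Module.finrank k V

namespace ReeHexagon

variable {k V : Type*} [Field k] [AddCommGroup V] [Module k V] (H : ReeHexagon k V)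

lemma cr_comm {x y : V} (h : H.cr x y = 0) : H.cr y x = 0 := by
  rw [H.cr_swap, h, neg_zero]

lemma cr_self (x : V) : H.cr x x = 0 := by
  have h := H.cr_swap x x
  have h' : (2 : k) • H.cr x x = 0 := by
    rw [two_smul]; nth_rewrite 1 [h]; simp
  exact (smul_eq_zero.1 h').resolve_left H.two_ne

lemma ζ_add_left {x y z : V} (a b : k) (hx : H.cr x z = 0) (hy : H.cr y z = 0) :
    H.ζ (a • x + b • y) z = H.τ a • H.ζ x z + H.τ b • H.ζ y z := by
  have h : H.cr z (a • x + b • y) = 0 := by simp [H.cr_comm hx, H.cr_comm hy]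
  rw [H.ζ_swap _ _ h, H.ζ_lin _ _ _ _ _ (H.cr_comm hx) (H.cr_comm hy), H.ζ_swap _ _ hx,
    H.ζ_swap _ _ hy]
  module

lemma ζ_smul_right {x y : V} (a : k) (h : H.cr x y = 0) :
    H.ζ x (a • y) = H.τ a • H.ζ x y := by
  simpa using H.ζ_lin x y y a 0 h h

lemma ζ_smul_left {x y : V} (a : k) (h : H.cr x y = 0) :
    H.ζ (a • x) y = H.τ a • H.ζ x y := by
  simpa using H.ζ_add_left a 0 h h

lemma ζ_zero_right (x : V) : H.ζ x 0 = 0 := by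
  simpa using H.ζ_smul_right (x := x) (y := x) 0 (H.cr_self x)

lemma B_eq_zero_of_cr {x y : V} (hx : x ≠ 0) (hxx : H.B x x = 0) (h : H.cr x y = 0) :
    H.B x y = 0 := by
  have := H.cr_cr x x y
  rw [h, hxx] at this
  simp only [map_zero, add_zero, zero_smul, sub_zero] at this
  have h2 : (2 * H.B x y) • x = 0 := by
    rw [mul_smul, two_smul, ← neg_eq_zero, neg_add']
    exact this.symm
  simpa [hx, H.two_ne] using h2

lemma B_self_of_cr {x y : V} (h : H.cr x y = 0) (hy : ¬ ∃ c : k, y = c • x) :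
    H.B x x = 0 := by
  have := H.cr_cr x x y
  rw [h] at this
  simp only [map_zero, add_zero] at this
  by_contra hne
  refine hy ⟨-(H.B x x)⁻¹ * (2 * H.B x y), ?_⟩
  have h2 : H.B x x • y = -(2 * H.B x y) • x := by
    rw [neg_smul, mul_smul, two_smul, neg_add', sub_eq_zero.1 this.symm]
  calc y = (H.B x x)⁻¹ • (H.B x x • y) := by rw [smul_smul, inv_mul_cancel₀ hne, one_smul]
    _ = _ := by rw [h2, smul_smul]; ring_nf

lemma B_eq_zero_of_common {x y z : V} (hx : x ≠ 0) (hxx : H.B x x = 0) (hy : H.cr x y = 0)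
    (hz : H.cr x z = 0) : H.B y z = 0 := by
  have := H.cr_cr y z x
  rw [H.cr_comm hy, H.cr_comm hz, H.B_symm y x, H.B_symm z x, H.B_eq_zero_of_cr hx hxx hy,
    H.B_eq_zero_of_cr hx hxx hz] at this
  simpa [hx] using this

lemma cr_cr_self {x y : V} (hxx : H.B x x = 0) (hxy : H.B x y = 0) :
    H.cr x (H.cr x y) = 0 := by
  have := H.cr_cr x x y
  rw [hxx, hxy] at this
  have h2 : (2 : k) • H.cr x (H.cr x y) = 0 := by
    rw [two_smul, this]; simp
  exact (smul_eq_zero.1 h2).resolve_left H.two_ne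

lemma cr_ζ_ζ_self {x y z : V} (hx : x ≠ 0) (hxx : H.B x x = 0) (hy : H.cr x y = 0)
    (hz : H.cr x z = 0) : H.cr (H.ζ x y) (H.ζ x z) = 0 := by
  rw [H.cr_ζ_ζ x y x z hy hz hz hxx (H.B_eq_zero_of_common hx hxx hy hz)
    (H.B_eq_zero_of_cr hx hxx hz), H.B_symm y x, H.B_eq_zero_of_cr hx hxx hy]
  simp

/-- Two collinear points with nonzero product are independent. -/
lemma not_smul_of_ζ {x y : V} (h : H.ζ x y ≠ 0) : ¬ ∃ c : k, y = c • x := by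
  rintro ⟨c, rfl⟩
  exact h (by rw [H.ζ_smul_right c (H.cr_self x), H.ζ_self, smul_zero])

lemma left_ne_zero_of_ζ {x y : V} (h : H.ζ x y ≠ 0) : x ≠ 0 := by
  rintro rfl
  apply h
  have h0 : H.cr (0 : V) y = 0 := by simp
  rw [← neg_eq_zero, ← H.ζ_swap _ _ h0, H.ζ_zero_right]

lemma exists_mem_line {x z w : V} (hxx : H.B x x = 0) (hz : z ≠ 0)
    (hw : ¬ ∃ c : k, w = c • z) (hzw : H.cr z w = 0) (hxz : H.B x z = 0) (hxw : H.B x w = 0) :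
    ∃ a b : k, a • z + b • w ≠ 0 ∧ H.cr x (a • z + b • w) = 0 := by
  by_cases hy : H.cr x z = 0
  · exact ⟨1, 0, by simpa using hz, by simpa using hy⟩
  have hzz := H.B_self_of_cr hzw hw
  have hyz : H.cr z (H.cr x z) = 0 := by
    rw [H.cr_swap z x, map_neg, H.cr_cr_self hzz (by rw [H.B_symm, hxz]), neg_zero]
  have hyw : H.cr w (H.cr x z) = 0 := by
    have := H.cr_cr w x z
    rw [H.cr_comm hzw, hxz, H.B_symm w x, hxw, H.B_symm w z, H.B_eq_zero_of_cr hz hzz hzw] at this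
    simpa using this
  obtain ⟨a, b, hab⟩ := H.triangle z w (H.cr x z) hz hw hzw hyz hyw
  exact ⟨a, b, by rwa [← hab], by rw [← hab]; exact H.cr_cr_self hxx hxz⟩

/-- A point `b` which is, up to a scalar, the product of itself with some point of its plane. -/
def IsLoop (b : V) : Prop := b ≠ 0 ∧ ∃ y, H.cr b y = 0 ∧ H.ζ b y = b

lemma isLoop_of_smul {b y : V} {c : k} (hb : b ≠ 0) (h : H.cr b y = 0) (hc : c ≠ 0)
    (hy : H.ζ b y = c • b) : H.IsLoop b := by
  refine ⟨hb, H.τ.symm c⁻¹ • y, by simp [h], ?_⟩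
  rw [H.ζ_smul_right _ h, hy, RingEquiv.apply_symm_apply, smul_smul, inv_mul_cancel₀ hc, one_smul]

lemma IsLoop.smul {b : V} (h : H.IsLoop b) {c : k} (hc : c ≠ 0) : H.IsLoop (c • b) := by
  obtain ⟨hb, y, hy, hby⟩ := h
  refine H.isLoop_of_smul (y := y) (c := H.τ c / c) (smul_ne_zero hc hb) (by simp [hy])
    (by simp [hc]) ?_
  rw [H.ζ_smul_left c hy, hby, smul_smul, div_mul_cancel₀ _ hc]

lemma IsLoop.B_self {b : V} (h : H.IsLoop b) : H.B b b = 0 := by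
  obtain ⟨hb, y, hy, hby⟩ := h
  exact H.B_self_of_cr hy (H.not_smul_of_ζ (by rwa [hby]))

lemma exists_loop_of_cr {x w v : V} {c : k} (hx : x ≠ 0) (hxx : H.B x x = 0) (hw : H.cr x w = 0)
    (hv : H.cr x v = 0) (hc : c ≠ 0) (hwv : H.ζ (H.ζ x w) (H.ζ x v) = c • x)
    (hz : H.cr x (H.ζ x w) = 0) : ∃ b, H.IsLoop b ∧ H.cr x b = 0 := by
  set z := H.ζ x w with hzdef
  set z₂ := H.ζ x v with hz₂def
  have hζ : H.ζ z z₂ ≠ 0 := by rw [hwv]; exact smul_ne_zero hc hx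
  have hz0 : z ≠ 0 := H.left_ne_zero_of_ζ hζ
  have hzz₂ : H.cr z z₂ = 0 := H.cr_ζ_ζ_self hx hxx hw hv
  have hzz : H.B z z = 0 := H.B_self_of_cr hzz₂ (H.not_smul_of_ζ hζ)
  by_cases h1 : ∃ a : k, z = a • x
  · obtain ⟨a, ha⟩ := h1
    refine ⟨x, H.isLoop_of_smul hx hw (c := a) ?_ ha, H.cr_self x⟩
    rintro rfl
    exact hz0 (by simpa using ha)
  have h2 : H.ζ x z ≠ 0 := fun h => h1 (H.ζ_eq_zero x z hx hz h)
  by_cases h3 : ∃ a : k, H.ζ x z = a • z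
  · obtain ⟨a, ha⟩ := h3
    refine ⟨z, H.isLoop_of_smul (y := x) (c := -a) hz0 (H.cr_comm hz) ?_ ?_, hz⟩
    · rintro h
      rw [neg_eq_zero] at h
      exact h2 (by simpa [h] using ha)
    · rw [H.ζ_swap _ _ hz, ha, neg_smul]
  have h4 : H.cr x (H.ζ x z) = 0 := by
    have := H.cr_ζ_ζ z z₂ x z hzz₂ hz (H.cr_self z)
      (H.B_symm x z ▸ H.B_eq_zero_of_cr hx hxx hz)
      (H.B_symm z z₂ ▸ H.B_eq_zero_of_cr hz0 hzz hzz₂) hzz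
    rw [hwv, H.ζ_self, smul_zero] at this
    simpa [hc] using this
  have h5 : H.cr z (H.ζ x z) = 0 := H.cr_ζ_ζ_self hx hxx hw hz
  obtain ⟨a, b, hab⟩ := H.triangle z (H.ζ x z) x hz0 h3 h5 (H.cr_comm hz) (H.cr_comm h4)
  refine ⟨x, ⟨hx, H.τ.symm a • w + H.τ.symm b • z, by simp [hw, hz], ?_⟩, H.cr_self x⟩
  rw [H.ζ_lin _ _ _ _ _ hw hz]
  simp only [RingEquiv.apply_symm_apply]
  exact hab.symm

lemma exists_loop_of_B {x w v : V} {c : k} (hx : x ≠ 0) (hxx : H.B x x = 0) (hw : H.cr x w = 0)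
    (hv : H.cr x v = 0) (hc : c ≠ 0) (hwv : H.ζ (H.ζ x w) (H.ζ x v) = c • x)
    (hz : H.B x (H.ζ x w) = 0) (hz₂ : H.B x (H.ζ x v) ≠ 0) :
    ∃ b, H.IsLoop b ∧ H.cr x b = 0 := by
  by_cases hcr : H.cr x (H.ζ x w) = 0
  · exact H.exists_loop_of_cr hx hxx hw hv hc hwv hcr
  set z := H.ζ x w with hzdef
  set z₂ := H.ζ x v with hz₂def
  have hζ : H.ζ z z₂ ≠ 0 := by rw [hwv]; exact smul_ne_zero hc hx
  have hz0 : z ≠ 0 := H.left_ne_zero_of_ζ hζ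
  have hzz₂ : H.cr z z₂ = 0 := H.cr_ζ_ζ_self hx hxx hw hv
  have hind := H.not_smul_of_ζ hζ
  have hzz : H.B z z = 0 := H.B_self_of_cr hzz₂ hind
  set y := H.cr x z with hydef
  have hzx : H.B z x = 0 := by rw [H.B_symm, hz]
  have hxy : H.cr x y = 0 := H.cr_cr_self hxx hz
  have hzy : H.cr z y = 0 := by
    rw [hydef, H.cr_swap z x, map_neg, H.cr_cr_self hzz hzx, neg_zero]
  have hBzy := H.B_eq_zero_of_cr hz0 hzz hzy
  have hyx : ¬ ∃ a : k, y = a • x := by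
    rintro ⟨a, ha⟩
    have : a ≠ 0 := by rintro rfl; exact hcr (by simpa using ha)
    rw [ha] at hzy
    exact hcr (H.cr_comm (by simpa [this] using hzy))
  have hζxy : H.ζ x y ≠ 0 := fun h => hyx (H.ζ_eq_zero x y hx hxy h)
  have hB : H.B x (H.ζ x y) = 0 := by
    have := H.B_ζ_ζ z z₂ x y hzz₂ hxy
    rw [hwv, hzx, hBzy] at this
    simpa [hc] using this
  obtain ⟨a, b, hab⟩ := H.triangle z z₂ (H.ζ x y) hz0 hind hzz₂
    (H.cr_ζ_ζ_self hx hxx hw hxy) (H.cr_ζ_ζ_self hx hxx hv hxy)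
  have hb : b = 0 := by
    rw [hab] at hB
    simpa [hz, hz₂] using hB
  subst hb
  rw [zero_smul, add_zero] at hab
  have ha : a ≠ 0 := by rintro rfl; exact hζxy (by simpa using hab)
  have key := H.cr_ζ_ζ z z₂ x y hzz₂ hxy hzy hzx (H.B_eq_zero_of_common hz0 hzz hzz₂ hzy) hBzy
  rw [hwv, hab, H.B_symm z₂ x] at key
  have hK : H.C * H.τ (H.B x z₂) ≠ 0 := mul_ne_zero H.C_ne (by simpa using hz₂)
  set K := H.C * H.τ (H.B x z₂)
  have hy0 : y ≠ 0 := hcr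
  refine ⟨y, H.isLoop_of_smul (y := z) (c := -(K⁻¹ * (c * a))) hy0 (H.cr_comm hzy) ?_ ?_, hxy⟩
  · simp [hK, hc, ha]
  · rw [H.ζ_swap _ _ hzy, neg_smul, mul_smul, mul_smul]
    have : c • a • y = K • H.ζ z y := by
      rw [← key, smul_comm]; simp [hydef]
    rw [this, smul_smul, inv_mul_cancel₀ hK, one_smul]

/-- The points collinear with `x`. -/
def plane (x : V) : Submodule k V := LinearMap.ker (H.cr x)

lemma mem_plane {x y : V} : y ∈ H.plane x ↔ H.cr x y = 0 := Iff.rfl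

lemma three_le_finrank_plane {x : V} (hxx : H.B x x = 0) :
    3 ≤ Module.finrank k (H.plane x) := by
  have hfin : Module.Finite k V := Module.finite_of_finrank_pos (by have := H.seven_le; lia)
  let P := LinearMap.ker (H.B x)
  let f : P →ₗ[k] V := (H.cr x).domRestrict P
  have h1 := LinearMap.finrank_range_add_finrank_ker (H.B x)
  have h2 := LinearMap.finrank_range_add_finrank_ker f
  have h3 : Module.finrank k (LinearMap.range (H.B x)) ≤ 1 := by
    simpa using Submodule.finrank_le (LinearMap.range (H.B x))
  have h4 : Module.finrank k (LinearMap.range f) ≤ Module.finrank k (H.plane x) := by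
    refine Submodule.finrank_mono ?_
    rintro _ ⟨y, rfl⟩
    exact H.cr_cr_self hxx y.2
  have h5 : Module.finrank k (LinearMap.ker f) ≤ Module.finrank k (H.plane x) := by
    refine LinearMap.finrank_le_finrank_of_injective
      (f := (P.subtype.comp (LinearMap.ker f).subtype).codRestrict (H.plane x) ?_) ?_
    · intro y
      exact y.2
    · intro y z h
      have := congrArg Subtype.val h
      exact Subtype.ext (Subtype.ext this)
  have h6 := H.seven_le
  change _ = Module.finrank k (LinearMap.ker (H.B x)) at h2
  omega

lemma exists_notMem_of_finrank_lt {W : Type*} [AddCommGroup W] [Module k W]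
    (P : Submodule k W) (S : Set W) [Finite S] (hS : Nat.card S < Module.finrank k P) :
    ∃ y ∈ P, y ∉ Submodule.span k S := by
  by_contra! h
  have : Fintype S := Fintype.ofFinite S
  have h1 : Module.finrank k P ≤ Module.finrank k (Submodule.span k S) :=
    have : Module.Finite k (Submodule.span k S) :=
      Module.Finite.span_of_finite k (Set.toFinite S)
    Submodule.finrank_mono h
  have h2 := finrank_span_le_card (R := k) S
  rw [Nat.card_eq_card_toFinset S] at hS
  lia

lemma exists_plane {x : V} (hxx : H.B x x = 0) :
    ∃ y z, H.cr x y = 0 ∧ H.cr x z = 0 ∧ (¬ ∃ a : k, y = a • x) ∧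
      ¬ ∃ a b : k, z = a • x + b • y := by
  have h := H.three_le_finrank_plane hxx
  obtain ⟨y, hy, hyx⟩ := exists_notMem_of_finrank_lt (H.plane x) {x} (by simp; lia)
  obtain ⟨z, hz, hzx⟩ := exists_notMem_of_finrank_lt (H.plane x) {x, y}
    (lt_of_le_of_lt (b := 2) (by
      exact (Set.ncard_insert_le x {y}).trans (by simp)) (by lia))
  refine ⟨y, z, hy, hz, ?_, ?_⟩
  · rintro ⟨a, rfl⟩
    exact hyx (Submodule.mem_span_singleton.2 ⟨a, rfl⟩)
  · rintro ⟨a, b, rfl⟩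
    exact hzx (Submodule.mem_span_pair.2 ⟨a, b, rfl⟩)

lemma finrank_plane {x : V} (hx : x ≠ 0) (hxx : H.B x x = 0) :
    Module.finrank k (H.plane x) = 3 := by
  refine le_antisymm ?_ (H.three_le_finrank_plane hxx)
  obtain ⟨y, z, hy, hz, hyx, hzx⟩ := H.exists_plane hxx
  obtain ⟨c, hc, hc0⟩ := H.ζ_ζ_ζ x y z hx hxx hy hz
  have hc0 : c ≠ 0 := fun h => (hc0 h).elim hyx hzx
  have hle : H.plane x ≤ Submodule.span k (Set.range ![x, y, z]) := by
    intro w hw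
    rw [mem_plane] at hw
    obtain ⟨d, hd, -⟩ := H.ζ_ζ_ζ x y w hx hxx hy hw
    let l := -(H.τ.symm (H.τ.symm (d / c)))
    obtain ⟨d', hd', hd0⟩ := H.ζ_ζ_ζ x y ((1 : k) • w + l • z) hx hxx hy (by simp [hw, hz])
    have h0 : d' • x = 0 := by
      rw [← hd', H.ζ_lin _ _ _ _ _ hw hz, H.ζ_lin _ _ _ _ _ (H.cr_ζ_ζ_self hx hxx hy hw)
        (H.cr_ζ_ζ_self hx hxx hy hz), hc, hd, smul_smul]
      simp only [l, map_one, map_neg, RingEquiv.apply_symm_apply, neg_smul]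
      rw [smul_smul, div_mul_cancel₀ _ hc0, one_mul, add_neg_cancel]
    obtain ⟨a, b, hab⟩ := (hd0 ((smul_eq_zero.1 h0).resolve_right hx)).resolve_left hyx
    have : w = a • x + b • y + (-l) • z := by
      rw [← hab]; module
    rw [this]
    refine add_mem (add_mem ?_ ?_) ?_ <;> refine Submodule.smul_mem _ _ (Submodule.subset_span ?_)
    · exact ⟨0, rfl⟩
    · exact ⟨1, rfl⟩
    · exact ⟨2, rfl⟩
  have h1 : Module.finrank k (H.plane x) ≤ Module.finrank k
      (Submodule.span k (Set.range ![x, y, z])) :=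
    have : Module.Finite k (Submodule.span k (Set.range ![x, y, z])) :=
      Module.Finite.span_of_finite k (Set.toFinite _)
    Submodule.finrank_mono hle
  refine h1.trans ?_
  have h2 := finrank_range_le_card (R := k) ![x, y, z]
  rwa [Fintype.card_fin] at h2

/-- Every isotropic point lies in the plane of a loop. -/
theorem exists_loop {x : V} (hx : x ≠ 0) (hxx : H.B x x = 0) :
    ∃ b, H.IsLoop b ∧ H.cr x b = 0 := by
  obtain ⟨w, v, hw, hv, hwx, hvx⟩ := H.exists_plane hxx
  obtain ⟨c, hc, hc0⟩ := H.ζ_ζ_ζ x w v hx hxx hw hv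
  have hc0 : c ≠ 0 := fun h => (hc0 h).elim hwx hvx
  have hwv : H.cr (H.ζ x w) (H.ζ x v) = 0 := H.cr_ζ_ζ_self hx hxx hw hv
  have hvw : H.ζ (H.ζ x v) (H.ζ x w) = -c • x := by rw [H.ζ_swap _ _ hwv, hc, neg_smul]
  by_cases h2 : H.B x (H.ζ x v) = 0
  · by_cases h1 : H.B x (H.ζ x w) = 0
    · have hζ : H.ζ (H.ζ x w) (H.ζ x v) ≠ 0 := by rw [hc]; exact smul_ne_zero hc0 hx
      obtain ⟨a, b, hm0, hm⟩ := H.exists_mem_line hxx (H.left_ne_zero_of_ζ hζ)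
        (H.not_smul_of_ζ hζ) hwv h1 h2
      set u := H.τ.symm a • w + H.τ.symm b • v
      have hu : H.cr x u = 0 := by simp [u, hw, hv]
      have hzu : H.ζ x u = a • H.ζ x w + b • H.ζ x v := by
        simp only [u]; rw [H.ζ_lin _ _ _ _ _ hw hv]; simp
      by_cases ha : a = 0
      · have hb : b ≠ 0 := by
          rintro rfl; simp [ha] at hm0
        refine H.exists_loop_of_cr (w := u) (v := w) (c := H.τ b * -c) hx hxx hu hw ?_ ?_ ?_
        · simp [hb, hc0]
        · rw [hzu, ha, zero_smul, zero_add, H.ζ_smul_left b (H.cr_comm hwv), hvw, mul_smul]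
        · rwa [hzu]
      · refine H.exists_loop_of_cr (w := u) (v := v) (c := H.τ a * c) hx hxx hu hv ?_ ?_ ?_
        · simp [ha, hc0]
        · rw [hzu, H.ζ_add_left a b hwv (H.cr_self _), hc, H.ζ_self, smul_zero, add_zero, mul_smul]
        · rwa [hzu]
    · exact H.exists_loop_of_B hx hxx hv hw (neg_ne_zero.2 hc0) hvw h2 h1
  · set a : k := -(H.B x (H.ζ x w) / H.B x (H.ζ x v))
    set u := (1 : k) • w + H.τ.symm a • v
    have hu : H.cr x u = 0 := by simp [u, hw, hv]
    have hzu : H.ζ x u = (1 : k) • H.ζ x w + a • H.ζ x v := by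
      simp only [u]; rw [H.ζ_lin _ _ _ _ _ hw hv]; simp
    refine H.exists_loop_of_B (w := u) (v := v) (c := c) hx hxx hu hv hc0 ?_ ?_ h2
    · rw [hzu, H.ζ_add_left _ _ hwv (H.cr_self _), hc, H.ζ_self]; simp
    · rw [hzu]; simp [a, h2]

lemma cr_cr_of_common {b b' p : V} (hb : b ≠ 0) (hbb : H.B b b = 0) (hb' : b' ≠ 0)
    (hbb' : H.B b' b' = 0) (h : H.B b b' = 0) (hp : H.cr b p = 0) (hp' : H.cr b' p = 0) :
    H.cr p (H.cr b b') = 0 := by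
  have := H.cr_cr p b b'
  rw [H.cr_comm hp', h, H.B_symm p b', H.B_symm p b, H.B_eq_zero_of_cr hb hbb hp,
    H.B_eq_zero_of_cr hb' hbb' hp'] at this
  simpa using this

lemma eq_smul_of_common {b b' p : V} (hb : b ≠ 0) (hbb : H.B b b = 0) (hb' : b' ≠ 0)
    (hbb' : H.B b' b' = 0) (h : H.B b b' = 0) (hp : H.cr b p = 0) (hp' : H.cr b' p = 0)
    (hcr : H.cr b b' ≠ 0) : ∃ c : k, p = c • H.cr b b' := by
  by_contra hc
  have hpc := H.cr_comm (H.cr_cr_of_common hb hbb hb' hbb' h hp hp')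
  have h1 : H.cr (H.cr b b') b = 0 := H.cr_comm (H.cr_cr_self hbb h)
  have h2 : H.cr (H.cr b b') b' = 0 := by
    apply H.cr_comm
    rw [H.cr_swap b' b, map_neg, H.cr_cr_self hbb' (by rw [H.B_symm, h]), neg_zero]
  obtain ⟨a₁, a₂, ha⟩ := H.triangle _ p b hcr hc hpc h1 (H.cr_comm hp)
  obtain ⟨c₁, c₂, hc'⟩ := H.triangle _ p b' hcr hc hpc h2 (H.cr_comm hp')
  have key : ∀ d, H.cr d p = 0 → b = a₁ • d + a₂ • p → b' = c₁ • d + c₂ • p →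
      H.cr b b' = 0 := by
    rintro d hd rfl rfl
    simp [H.cr_self, hd, H.cr_comm hd]
  exact hcr (key _ hpc ha hc')

lemma false_of_B {b b' y y' : V} (hb : b ≠ 0) (hy : H.cr b y = 0) (hby : H.ζ b y = b)
    (hb' : b' ≠ 0) (hy' : H.cr b' y' = 0) (hby' : H.ζ b' y' = b') (h : H.B b b' = 0)
    (hcr : H.cr b b' ≠ 0) (hB : H.B b y' = 0) : False := by
  have hbb := H.B_self_of_cr hy (H.not_smul_of_ζ (by rwa [hby]))
  have hind : ¬ ∃ c : k, y' = c • b' := H.not_smul_of_ζ (by rwa [hby'])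
  have hbb' := H.B_self_of_cr hy' hind
  obtain ⟨α, β, hm0, hbm⟩ := H.exists_mem_line hbb hb' hind hy' h hB
  set m := α • b' + β • y'
  have hb'm : H.cr b' m = 0 := by simp [m, H.cr_self, hy']
  have hζm : H.ζ b' m = H.τ β • b' := by
    simp only [m]; rw [H.ζ_lin _ _ _ _ _ (H.cr_self b') hy', H.ζ_self, hby']; simp
  have hβ : β ≠ 0 := by
    rintro rfl
    have hα : α ≠ 0 := by rintro rfl; simp [m] at hm0
    simp [m, hα, hcr] at hbm
  have hmm : H.B m m = 0 := by
    refine H.B_self_of_cr (H.cr_comm hb'm) (H.not_smul_of_ζ ?_)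
    rw [H.ζ_swap _ _ hb'm, hζm]
    simp [hβ, hb']
  have hz0 : H.ζ b m ≠ 0 := fun h0 => by
    obtain ⟨c, hc⟩ := H.ζ_eq_zero b m hb hbm h0
    have hc0 : c ≠ 0 := by rintro rfl; exact hm0 (by simpa using hc)
    rw [hc] at hb'm
    exact hcr (H.cr_comm (by simpa [hc0] using hb'm))
  set z := H.ζ b m with hz
  have hbz : H.cr b z = 0 := by
    have := H.cr_ζ_ζ_self hb hbb hy hbm
    rwa [hby] at this
  have hb'z : H.cr b' z = 0 := by
    have := H.cr_ζ_ζ_self hm0 hmm (H.cr_comm hb'm) (H.cr_comm hbm)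
    rw [H.ζ_swap _ _ hb'm, H.ζ_swap _ _ hbm, hζm] at this
    simpa [hβ] using this
  obtain ⟨μ, hμ⟩ := H.eq_smul_of_common hb hbb hb' hbb' h hbm hb'm hcr
  obtain ⟨ν, hν⟩ := H.eq_smul_of_common hb hbb hb' hbb' h hbz hb'z hcr
  have hμ0 : μ ≠ 0 := by rintro rfl; exact hm0 (by simpa using hμ)
  have hν0 : ν ≠ 0 := by rintro rfl; exact hz0 (by simpa using hν)
  have hzm : z = (ν / μ) • m := by rw [hμ, hν, smul_smul, div_mul_cancel₀ _ hμ0]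
  obtain ⟨c, hc, -⟩ := H.ζ_ζ_ζ b y m hb hbb hy hbm
  rw [hby, ← hz] at hc
  have h1 : H.ζ b z = H.τ (ν / μ) • z := by
    conv_lhs => rw [hzm, H.ζ_smul_right _ hbm]
  have hκ : H.τ (ν / μ) ≠ 0 := by simp [hν0, hμ0]
  have hzb : z = ((H.τ (ν / μ))⁻¹ * c) • b := by
    rw [mul_smul, ← hc, h1, smul_smul, inv_mul_cancel₀ hκ, one_smul]
  have hc0 : (H.τ (ν / μ))⁻¹ * c ≠ 0 := by
    intro h0
    rw [h0, zero_smul] at hzb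
    exact hz0 hzb
  rw [hzb, map_smul] at hb'z
  exact hcr (H.cr_comm ((smul_eq_zero.1 hb'z).resolve_left hc0))

/-- Two loops collinear with a common isotropic point are proportional. -/
theorem IsLoop.eq_smul {x b b' : V} (hb : H.IsLoop b) (hb' : H.IsLoop b') (hx : x ≠ 0)
    (hxx : H.B x x = 0) (hxb : H.cr x b = 0) (hxb' : H.cr x b' = 0) : ∃ c : k, b' = c • b := by
  by_contra hne
  have hbb := IsLoop.B_self H hb
  have hbb' := IsLoop.B_self H hb'
  obtain ⟨hb0, y, hy, hby⟩ := hb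
  obtain ⟨hb0', y', hy', hby'⟩ := hb'
  have h : H.B b b' = 0 := H.B_eq_zero_of_common hx hxx hxb hxb'
  by_cases hcr : H.cr b b' = 0
  · set z := H.ζ b b' with hz
    have hz0 : z ≠ 0 := fun h0 => hne (H.ζ_eq_zero b b' hb0 hcr h0)
    have hbz : H.cr b z = 0 := by
      have := H.cr_ζ_ζ_self hb0 hbb hy hcr
      rwa [hby] at this
    have hb'z : H.cr b' z = 0 := by
      have := H.cr_ζ_ζ_self hb0' hbb' hy' (H.cr_comm hcr)
      rw [hby', H.ζ_swap _ _ hcr] at this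
      simpa using this
    obtain ⟨l, μ, hlμ⟩ := H.triangle b b' z hb0 hne hcr hbz hb'z
    obtain ⟨c, hc, -⟩ := H.ζ_ζ_ζ b y b' hb0 hbb hy hcr
    obtain ⟨c', hc', -⟩ := H.ζ_ζ_ζ b' y' b hb0' hbb' hy' (H.cr_comm hcr)
    rw [hby, ← hz] at hc
    rw [hby', H.ζ_swap _ _ hcr, ← hz] at hc'
    have h1 : H.ζ b z = H.τ μ • z := by
      rw [hlμ, H.ζ_lin _ _ _ _ _ (H.cr_self b) hcr, H.ζ_self, ← hz, ← hlμ]; simp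
    have h2 : H.ζ b' (-z) = H.τ l • z := by
      have : -z = (-l) • b + (-μ) • b' := by rw [hlμ]; module
      rw [this, H.ζ_lin _ _ _ _ _ (H.cr_comm hcr) (H.cr_self b'), H.ζ_self,
        H.ζ_swap _ _ hcr, ← hz]
      simp
    have hμ : μ = 0 := by
      by_contra hμ
      have hτ : H.τ μ ≠ 0 := by simpa using hμ
      have hzb : z = ((H.τ μ)⁻¹ * c) • b := by
        rw [mul_smul, ← hc, h1, smul_smul, inv_mul_cancel₀ hτ, one_smul]
      refine hne ⟨μ⁻¹ * ((H.τ μ)⁻¹ * c - l), ?_⟩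
      rw [mul_smul, sub_smul, ← hzb, hlμ, add_sub_cancel_left, smul_smul, inv_mul_cancel₀ hμ,
        one_smul]
    subst hμ
    have hl : l ≠ 0 := by rintro rfl; exact hz0 (by simpa using hlμ)
    have hτ : H.τ l ≠ 0 := by simpa using hl
    have hzb : z = ((H.τ l)⁻¹ * c') • b' := by
      rw [mul_smul, ← hc', h2, smul_smul, inv_mul_cancel₀ hτ, one_smul]
    have hk : (H.τ l)⁻¹ * c' ≠ 0 := by
      intro h0
      rw [h0, zero_smul] at hzb
      exact hz0 hzb
    refine hne ⟨((H.τ l)⁻¹ * c')⁻¹ * l, ?_⟩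
    have : l • b = ((H.τ l)⁻¹ * c') • b' := by rw [← hzb, hlμ]; simp
    rw [mul_smul, this, smul_smul, inv_mul_cancel₀ hk, one_smul]
  · have key := H.B_ζ_ζ b y b' y' hy hy'
    rw [hby, hby', h] at key
    have h0 : H.B b y' = 0 ∨ H.B b' y = 0 := by
      rw [H.B_symm b' y]
      simpa [H.D_ne] using key
    rcases h0 with h0 | h0
    · exact H.false_of_B hb0 hy hby hb0' hy' hby' h hcr h0
    · exact H.false_of_B hb0' hy' hby' hb0 hy hby (by rw [H.B_symm, h])
        (fun h => hcr (H.cr_comm h)) h0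

open Classical in
/-- Double counting of the pairs of a loop and a point of its plane. -/
theorem card_loops [Finite k] [Finite V] :
    Nat.card {b // H.IsLoop b} * (Nat.card k ^ 3 - 1)
      = Nat.card {x // x ≠ 0 ∧ H.B x x = 0} * (Nat.card k - 1) := by
  have := Fintype.ofFinite k
  have := Fintype.ofFinite V
  have key := Finset.card_mul_eq_card_mul (s := Finset.univ.filter H.IsLoop)
    (t := Finset.univ.filter fun x => x ≠ 0 ∧ H.B x x = 0) (fun b x => H.cr b x = 0)
    (m := Nat.card k ^ 3 - 1) (n := Nat.card k - 1) ?_ ?_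
  · simpa only [Nat.card_eq_fintype_card, Fintype.card_subtype] using key
  · intro b hb
    rw [Finset.mem_filter] at hb
    have hb0 : b ≠ 0 := hb.2.1
    have hbb := IsLoop.B_self H hb.2
    have h1 : Nat.card (H.plane b) = Nat.card k ^ 3 := by
      rw [Module.natCard_eq_pow_finrank (K := k), H.finrank_plane hb0 hbb]
    have h2 : (Finset.univ.filter fun x => x ∈ H.plane b).card = Nat.card k ^ 3 := by
      rw [← h1, Nat.card_eq_fintype_card, Fintype.card_subtype]
    rw [← h2, ← Finset.card_erase_of_mem (a := (0 : V)) (by simp)]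
    congr 1
    ext x
    simp only [Finset.mem_bipartiteAbove, Finset.mem_filter, Finset.mem_univ, true_and,
      Finset.mem_erase, mem_plane]
    refine ⟨fun h => ⟨h.1.1, h.2⟩, fun h => ⟨⟨h.1, ?_⟩, h.2⟩⟩
    exact H.B_eq_zero_of_common hb0 hbb h.2 h.2
  · intro x hx
    rw [Finset.mem_filter] at hx
    obtain ⟨-, hx0, hxx⟩ := hx
    obtain ⟨b, hb, hxb⟩ := H.exists_loop hx0 hxx
    have h1 : (Finset.univ.erase (0 : k)).card = Nat.card k - 1 := by
      rw [Finset.card_erase_of_mem (Finset.mem_univ _), Finset.card_univ, Nat.card_eq_fintype_card]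
    rw [← h1]
    symm
    refine Finset.card_bij (fun c _ => c • b) ?_ ?_ ?_
    · intro c hc
      have hc : c ≠ 0 := Finset.ne_of_mem_erase hc
      simp only [Finset.mem_bipartiteBelow, Finset.mem_filter, Finset.mem_univ, true_and]
      exact ⟨IsLoop.smul H hb hc, by simp [H.cr_comm hxb]⟩
    · intro c _ d _ h
      exact smul_left_injective k hb.1 h
    · intro b' hb'
      simp only [Finset.mem_bipartiteBelow, Finset.mem_filter, Finset.mem_univ, true_and] at hb'
      obtain ⟨c, rfl⟩ := IsLoop.eq_smul H hb hb'.1 hx0 hxx hxb (H.cr_comm hb'.2)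
      refine ⟨c, Finset.mem_erase.2 ⟨?_, Finset.mem_univ _⟩, rfl⟩
      rintro rfl
      exact hb'.1.1 (by simp)

end ReeHexagon

/-- A field of characteristic three with commuting endomorphisms `φ` of order dividing six and `σ`
such that `σ² = 3 φ` (where `3` is the Frobenius), and the inverse `τ` of `σ`. -/
structure ReeField (K : Type*) [Field K] where
  φ : K →+* K
  σ : K →+* K
  τ : K →+* K
  φ_six : ∀ x, φ (φ (φ (φ (φ (φ x))))) = x
  σ_φ : ∀ x, σ (φ x) = φ (σ x)
  σ_σ : ∀ x, σ (σ x) = φ x ^ 3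
  σ_τ : ∀ x, σ (τ x) = x
  τ_σ : ∀ x, τ (σ x) = x

namespace ReeField

lemma three_eq_zero (K : Type*) [Field K] [CharP K 3] : (3 : K) = 0 := by
  exact_mod_cast CharP.cast_eq_zero K 3

variable {K : Type*} [Field K] (R : ReeField K)

lemma τ_φ (x : K) : R.τ (R.φ x) = R.φ (R.τ x) := by
  conv_lhs => rw [← R.σ_τ x, ← R.σ_φ, R.τ_σ]

/-- The field fixed by `φ`. -/
def k : Subfield K := R.φ.eqLocusField (RingHom.id K)

lemma mem_k {x : K} : x ∈ R.k ↔ R.φ x = x := Iff.rfl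

lemma φ_k (a : R.k) : R.φ a = a := a.2

/-- The vectors `(x, e)` with `φ e = -e`. -/
def V : Submodule R.k (K × K) where
  carrier := {X | R.φ X.2 = -X.2}
  add_mem' := by
    intro X Y hX hY
    change R.φ (X.2 + Y.2) = -(X.2 + Y.2)
    rw [map_add, show R.φ X.2 = -X.2 from hX, show R.φ Y.2 = -Y.2 from hY]; ring
  zero_mem' := by change R.φ 0 = -0; simp
  smul_mem' := by
    intro a X hX
    change R.φ (a * X.2) = -(a * X.2)
    rw [map_mul, show R.φ X.2 = -X.2 from hX, R.φ_k]; ring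

lemma φ_snd (X : R.V) : R.φ X.1.2 = -X.1.2 := X.2

lemma V_ext {X Y : R.V} (h1 : X.1.1 = Y.1.1) (h2 : X.1.2 = Y.1.2) : X = Y :=
  Subtype.ext (Prod.ext h1 h2)

@[simp] lemma smul_fst (a : R.k) (X : R.V) : (a • X).1.1 = a * X.1.1 := rfl
@[simp] lemma smul_snd (a : R.k) (X : R.V) : (a • X).1.2 = a * X.1.2 := rfl
@[simp] lemma add_fst (X Y : R.V) : (X + Y).1.1 = X.1.1 + Y.1.1 := rfl
@[simp] lemma add_snd (X Y : R.V) : (X + Y).1.2 = X.1.2 + Y.1.2 := rfl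
@[simp] lemma neg_fst (X : R.V) : (-X).1.1 = -X.1.1 := rfl
@[simp] lemma neg_snd (X : R.V) : (-X).1.2 = -X.1.2 := rfl
@[simp] lemma sub_fst (X Y : R.V) : (X - Y).1.1 = X.1.1 - Y.1.1 := rfl
@[simp] lemma sub_snd (X Y : R.V) : (X - Y).1.2 = X.1.2 - Y.1.2 := rfl
@[simp] lemma zero_fst : (0 : R.V).1.1 = 0 := rfl
@[simp] lemma zero_snd : (0 : R.V).1.2 = 0 := rfl

/-- The antisymmetric expression whose partial traces enter the products. -/
def alt (x y : K) : K := x * R.φ (R.φ (R.φ y)) - R.φ (R.φ (R.φ x)) * y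

/-- The invariant symmetric form. -/
def B : R.V →ₗ[R.k] R.V →ₗ[R.k] R.k :=
  LinearMap.mk₂ R.k (fun X Y => ⟨
      X.1.1 * R.φ (R.φ (R.φ Y.1.1)) + R.φ X.1.1 * R.φ (R.φ (R.φ (R.φ Y.1.1)))
      + R.φ (R.φ X.1.1) * R.φ (R.φ (R.φ (R.φ (R.φ Y.1.1)))) + R.φ (R.φ (R.φ X.1.1)) * Y.1.1
      + R.φ (R.φ (R.φ (R.φ X.1.1))) * R.φ Y.1.1 + R.φ (R.φ (R.φ (R.φ (R.φ X.1.1)))) * R.φ (R.φ Y.1.1) + X.1.2 * Y.1.2, by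
      rw [mem_k]
      simp only [map_add, map_mul, R.φ_six, R.φ_snd]
      ring⟩)
    (by intros; apply Subtype.ext
        simp only [add_fst, add_snd, map_add, Subfield.coe_add]; ring)
    (by intros; apply Subtype.ext
        simp only [smul_fst, smul_snd, map_mul, R.φ_k, smul_eq_mul, Subfield.coe_mul]; ring)
    (by intros; apply Subtype.ext
        simp only [add_fst, add_snd, map_add, Subfield.coe_add]; ring)
    (by intros; apply Subtype.ext
        simp only [smul_fst, smul_snd, map_mul, R.φ_k, smul_eq_mul, Subfield.coe_mul]; ring)

lemma coe_B (X Y : R.V) : (R.B X Y : K) = X.1.1 * R.φ (R.φ (R.φ Y.1.1))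
    + R.φ X.1.1 * R.φ (R.φ (R.φ (R.φ Y.1.1)))
    + R.φ (R.φ X.1.1) * R.φ (R.φ (R.φ (R.φ (R.φ Y.1.1)))) + R.φ (R.φ (R.φ X.1.1)) * Y.1.1
    + R.φ (R.φ (R.φ (R.φ X.1.1))) * R.φ Y.1.1 + R.φ (R.φ (R.φ (R.φ (R.φ X.1.1)))) * R.φ (R.φ Y.1.1) + X.1.2 * Y.1.2 := rfl

/-- The cross product. -/
def cr : R.V →ₗ[R.k] R.V →ₗ[R.k] R.V :=
  LinearMap.mk₂ R.k (fun X Y => ⟨(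
      R.φ (R.φ (R.φ (R.φ (R.φ X.1.1)))) * R.φ Y.1.1 - R.φ X.1.1 * R.φ (R.φ (R.φ (R.φ (R.φ Y.1.1))))
        + X.1.2 * Y.1.1 - Y.1.2 * X.1.1,
      R.alt X.1.1 Y.1.1 - R.φ (R.alt X.1.1 Y.1.1) + R.φ (R.φ (R.alt X.1.1 Y.1.1))), by
      change R.φ _ = - _
      simp only [alt, map_add, map_sub, map_mul, R.φ_six]
      ring⟩)
    (by intros; apply R.V_ext <;> simp only [add_fst, add_snd, alt, map_add, map_sub, map_mul] <;>
        ring)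
    (by intros; apply R.V_ext <;>
        simp only [smul_fst, smul_snd, alt, map_sub, map_mul, R.φ_k] <;> ring)
    (by intros; apply R.V_ext <;> simp only [add_fst, add_snd, alt, map_add, map_sub, map_mul] <;>
        ring)
    (by intros; apply R.V_ext <;>
        simp only [smul_fst, smul_snd, alt, map_sub, map_mul, R.φ_k] <;> ring)

lemma cr_fst (X Y : R.V) : (R.cr X Y).1.1 =
    R.φ (R.φ (R.φ (R.φ (R.φ X.1.1)))) * R.φ Y.1.1 - R.φ X.1.1 * R.φ (R.φ (R.φ (R.φ (R.φ Y.1.1))))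
      + X.1.2 * Y.1.1 - Y.1.2 * X.1.1 := rfl

lemma cr_snd (X Y : R.V) : (R.cr X Y).1.2 =
    R.alt X.1.1 Y.1.1 - R.φ (R.alt X.1.1 Y.1.1) + R.φ (R.φ (R.alt X.1.1 Y.1.1)) := rfl

/-- The first component of the product, twisted by `σ`. -/
def pr (X Y : R.V) : K := X.1.1 * R.φ Y.1.1 - R.φ X.1.1 * Y.1.1

/-- The second component of the product, twisted by `σ`. -/
def pr' (X Y : R.V) : K := R.alt X.1.1 Y.1.1 + R.φ (R.alt X.1.1 Y.1.1)

open Classical in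
/-- The semilinear product of collinear vectors. -/
noncomputable def ζ (X Y : R.V) : R.V :=
  if h : R.φ (R.pr' X Y) = -R.pr' X Y then
    ⟨(R.τ (R.pr X Y), R.τ (R.pr' X Y)), by
      change R.φ (R.τ _) = - R.τ _
      rw [← R.τ_φ, h, map_neg]⟩
  else 0

lemma V_ext_σ {X Y : R.V} (h1 : R.σ X.1.1 = R.σ Y.1.1) (h2 : R.σ X.1.2 = R.σ Y.1.2) : X = Y :=
  R.V_ext (R.σ.injective h1) (R.σ.injective h2)

lemma B_symm (X Y : R.V) : R.B X Y = R.B Y X := by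
  apply Subtype.ext; rw [coe_B, coe_B]; ring

lemma cr_swap (X Y : R.V) : R.cr Y X = -R.cr X Y := by
  apply R.V_ext <;> simp only [neg_fst, neg_snd, cr_fst, cr_snd, alt, map_sub, map_mul] <;> ring

/-- The automorphism `τ` restricted to the fixed field of `φ`. -/
def τk : R.k ≃+* R.k where
  toFun a := ⟨R.τ a, by rw [mem_k, ← τ_φ, φ_k]⟩
  invFun a := ⟨R.σ a, by rw [mem_k, ← R.σ_φ, φ_k]⟩
  left_inv a := Subtype.ext (R.σ_τ a)
  right_inv a := Subtype.ext (R.τ_σ a)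
  map_mul' a b := Subtype.ext (map_mul R.τ _ _)
  map_add' a b := Subtype.ext (map_add R.τ _ _)

lemma σ_τk (a : R.k) : R.σ (R.τk a) = a := R.σ_τ a

variable [CharP K 3]

lemma cr_cr (X Y Z : R.V) : R.cr X (R.cr Y Z) + R.cr Y (R.cr X Z)
    = -(R.B X Z • Y) - R.B Y Z • X - R.B X Y • Z := by
  obtain ⟨⟨x, e⟩, he⟩ := X
  obtain ⟨⟨y, f⟩, hf⟩ := Y
  obtain ⟨⟨z, g⟩, hg⟩ := Z
  replace he : R.φ e = -e := he
  replace hf : R.φ f = -f := hf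
  replace hg : R.φ g = -g := hg
  apply R.V_ext
  · simp only [add_fst, sub_fst, neg_fst, smul_fst, coe_B, cr_fst, cr_snd, alt, map_add,
      map_sub, map_mul, map_neg, R.φ_six, he, hf, hg]
    clear he hf hg
    generalize R.φ (R.φ (R.φ (R.φ (R.φ x)))) = x5
    generalize R.φ (R.φ (R.φ (R.φ x))) = x4
    generalize R.φ (R.φ (R.φ x)) = x3
    generalize R.φ (R.φ x) = x2
    generalize R.φ x = x1
    generalize R.φ (R.φ (R.φ (R.φ (R.φ y)))) = y5
    generalize R.φ (R.φ (R.φ (R.φ y))) = y4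
    generalize R.φ (R.φ (R.φ y)) = y3
    generalize R.φ (R.φ y) = y2
    generalize R.φ y = y1
    generalize R.φ (R.φ (R.φ (R.φ (R.φ z)))) = z5
    generalize R.φ (R.φ (R.φ (R.φ z))) = z4
    generalize R.φ (R.φ (R.φ z)) = z3
    generalize R.φ (R.φ z) = z2
    generalize R.φ z = z1
    grind
  · simp only [add_snd, sub_snd, neg_snd, smul_snd, coe_B, cr_fst, cr_snd, alt, map_add,
      map_sub, map_mul, map_neg, R.φ_six, he, hf, hg]
    clear he hf hg
    generalize R.φ (R.φ (R.φ (R.φ (R.φ x)))) = x5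
    generalize R.φ (R.φ (R.φ (R.φ x))) = x4
    generalize R.φ (R.φ (R.φ x)) = x3
    generalize R.φ (R.φ x) = x2
    generalize R.φ x = x1
    generalize R.φ (R.φ (R.φ (R.φ (R.φ y)))) = y5
    generalize R.φ (R.φ (R.φ (R.φ y))) = y4
    generalize R.φ (R.φ (R.φ y)) = y3
    generalize R.φ (R.φ y) = y2
    generalize R.φ y = y1
    generalize R.φ (R.φ (R.φ (R.φ (R.φ z)))) = z5
    generalize R.φ (R.φ (R.φ (R.φ z))) = z4
    generalize R.φ (R.φ (R.φ z)) = z3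
    generalize R.φ (R.φ z) = z2
    generalize R.φ z = z1
    grind

lemma φ_pr' {X Y : R.V} (h : R.cr X Y = 0) : R.φ (R.pr' X Y) = -R.pr' X Y := by
  have h1 := R.cr_snd X Y
  rw [h, zero_snd] at h1
  simp only [pr', map_add]
  linear_combination -h1 + R.φ (R.alt X.1.1 Y.1.1) * three_eq_zero K

lemma σ_ζ_fst {X Y : R.V} (h : R.cr X Y = 0) : R.σ (R.ζ X Y).1.1 = R.pr X Y := by
  rw [ζ, dif_pos (R.φ_pr' h)]; exact R.σ_τ _

lemma σ_ζ_snd {X Y : R.V} (h : R.cr X Y = 0) : R.σ (R.ζ X Y).1.2 = R.pr' X Y := by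
  rw [ζ, dif_pos (R.φ_pr' h)]; exact R.σ_τ _

lemma ζ_self (X : R.V) : R.ζ X X = 0 := by
  have h : R.cr X X = 0 := by
    apply R.V_ext <;> simp only [zero_fst, zero_snd, cr_fst, cr_snd, alt, map_sub, map_mul] <;> ring
  apply R.V_ext_σ
  · rw [R.σ_ζ_fst h, zero_fst, map_zero, pr]; ring
  · rw [R.σ_ζ_snd h, zero_snd, map_zero, pr', alt]; simp only [map_sub, map_mul]; ring

lemma ζ_swap (X Y : R.V) (h : R.cr X Y = 0) : R.ζ Y X = - R.ζ X Y := by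
  have h' : R.cr Y X = 0 := by rw [cr_swap, h, neg_zero]
  apply R.V_ext_σ
  · rw [R.σ_ζ_fst h', neg_fst, map_neg, R.σ_ζ_fst h, pr, pr]; ring
  · rw [R.σ_ζ_snd h', neg_snd, map_neg, R.σ_ζ_snd h, pr', pr', alt, alt]
    simp only [map_sub, map_mul]; ring

lemma ζ_lin (X Y Y' : R.V) (a b : R.k) (h : R.cr X Y = 0) (h' : R.cr X Y' = 0) :
    R.ζ X (a • Y + b • Y') = R.τk a • R.ζ X Y + R.τk b • R.ζ X Y' := by
  have h'' : R.cr X (a • Y + b • Y') = 0 := by simp [h, h']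
  apply R.V_ext_σ
  · simp only [σ_ζ_fst, add_fst, smul_fst, map_add, map_mul, σ_τk, h, h', h'', pr, R.φ_k]; ring
  · simp only [σ_ζ_snd, add_fst, smul_fst, add_snd, smul_snd, map_add, map_mul, σ_τk, h, h', h'',
      pr', R.φ_k, alt, map_sub]; ring

end ReeField

/-- The equations, conjugated by the powers of `φ`, saying that two vectors are collinear. -/
structure ReeCollinear {K : Type*} [Field K] (x0 x1 x2 x3 x4 x5 e y0 y1 y2 y3 y4 y5 f : K) :
    Prop where
  c0 : x5 * y1 - x1 * y5 + e * y0 - f * x0 = 0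
  c1 : x0 * y2 - x2 * y0 - e * y1 + f * x1 = 0
  c2 : x1 * y3 - x3 * y1 + e * y2 - f * x2 = 0
  c3 : x2 * y4 - x4 * y2 - e * y3 + f * x3 = 0
  c4 : x3 * y5 - x5 * y3 + e * y4 - f * x4 = 0
  c5 : x4 * y0 - x0 * y4 - e * y5 + f * x5 = 0
  d : (x0 * y3 - x3 * y0) - (x1 * y4 - x4 * y1) + (x2 * y5 - x5 * y2) = 0

namespace ReeCollinear

variable {K : Type*} [Field K] [CharP K 3]

lemma plucker_B
    {p01 p02 p03 p04 p05 p07 p12 p13 p14 p15 p17 p23 p24 p25 p27 p34 p35 p37 p45 p47 p57 q01 q02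
    q03 q04 q05 q07 q12 q13 q14 q15 q17 q23 q24 q25 q27 q34 q35 q37 q45 q47 q57 : K}
    (h_p25 : p25 = p14 - p03)
    (h_p07 : p07 = -p15)
    (h_p17 : p17 = -p02)
    (h_p27 : p27 = p13)
    (h_p37 : p37 = -p24)
    (h_p47 : p47 = p35)
    (h_p57 : p57 = p04)
    (h_q25 : q25 = q14 - q03)
    (h_q07 : q07 = -q15)
    (h_q17 : q17 = -q02)
    (h_q27 : q27 = q13)
    (h_q37 : q37 = -q24)
    (h_q47 : q47 = q35)
    (h_q57 : q57 = q04)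
    :
    p01 * q34+p12 * q45+p23 * (-q05)+p34 * q01+p45 * q12+(-p05) * q23 + (p03 + p14) * (q03 + q14)
    =
    p01 * q34 + p02 * q35 + p03 * (-q03) + p04 * (-q13) + p05 * (-q23) + p07 * q37 + p12 * q45 +
    p13 * (-q04) + p14 * (-q14) + p15 * (-q24) + p17 * q47 + p23 * (-q05) + p24 * (-q15) + p25 *
    (-q25) + p27 * q57 + p34 * q01 + p35 * q02 + p37 * q07 + p45 * q12 + p47 * q17 + p57 * q27 := by
  subst h_p25 h_p07 h_p17 h_p27 h_p37 h_p47 h_p57 h_q25 h_q07 h_q17 h_q27 h_q37 h_q47 h_q57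
  grind

lemma plucker_cr_fst
    {p01 p02 p03 p04 p05 p07 p12 p13 p14 p15 p17 q01 q02 q03 q04 q05 q07 q12 q13 q14 q15 q17 : K}
    (h_p07 : p07 = -p15)
    (h_p17 : p17 = -p02)
    (h_q07 : q07 = -q15)
    (h_q17 : q17 = -q02)
    :
    (-p05) * q12 - p12 * (-q05) + (p03 + p14) * q01 - (q03 + q14) * p01 =
    (p03 * q01 - p13 * 0) + (p04 * 0 - p14 * (-q01)) + (p05 * (-q12) - p15 * (-q02)) + (0 *
    (-q13) - (-p01) * (-q03)) + (p01 * (-q14) - 0 * (-q04)) + (p02 * (-q15) - p12 * (-q05)) +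
    (p07 * (-q17) - p17 * (-q07)) := by
  subst h_p07 h_p17 h_q07 h_q17
  grind

lemma plucker_cr_snd
    {p01 p02 p03 p04 p05 p07 p12 p13 p14 p15 p17 p23 p24 p34 p35 p37 p45 p47 q01 q02 q03 q04 q05
    q07 q12 q13 q14 q15 q17 q23 q24 q34 q35 q37 q45 q47 : K}
    (h_p07 : p07 = -p15)
    (h_p17 : p17 = -p02)
    (h_p37 : p37 = -p24)
    (h_p47 : p47 = p35)
    (h_q07 : q07 = -q15)
    (h_q17 : q17 = -q02)
    (h_q37 : q37 = -q24)
    (h_q47 : q47 = q35)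
    :
    (p01 * q34 - p34 * q01) - (p12 * q45 - p45 * q12) + (p23 * (-q05) - (-p05) * q23) =
    (p03 * q03 - 0 * 0) + (p04 * q13 - p34 * (-q01)) + (p05 * q23 - p35 * (-q02)) + (0 * 0 -
    (-p03) * (-q03)) + (p01 * (-q34) - (-p13) * (-q04)) + (p02 * (-q35) - (-p23) * (-q05)) + (p07
    * (-q37) - p37 * (-q07)) + (p13 * q04 - (-p34) * q01) + (p14 * q14 - 0 * 0) + (p15 * q24 -
    p45 * (-q12)) + ((-p01) * q34 - (-p04) * (-q13)) + (0 * 0 - (-p14) * (-q14)) + (p12 * (-q45)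
    - (-p24) * (-q15)) + (p17 * (-q47) - p47 * (-q17)) := by
  subst h_p07 h_p17 h_p37 h_p47 h_q07 h_q17 h_q37 h_q47
  grind

lemma plucker_B_eq {z0 z1 z2 z3 z4 z5 g w0 w1 w2 w3 w4 w5 l x0 x1 x2 x3 x4 x5 e y0 y1 y2 y3 y4 y5 f : K}
    (hp : ReeCollinear z0 z1 z2 z3 z4 z5 g w0 w1 w2 w3 w4 w5 l) (hq : ReeCollinear x0 x1 x2 x3 x4 x5 e y0 y1 y2 y3 y4 y5 f) :
    (z0 * w1 - z1 * w0) * (x3 * y4 - x4 * y3) + (z1 * w2 - z2 * w1) * (x4 * y5 - x5 * y4) + (z2 *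
    w3 - z3 * w2) * (x5 * y0 - x0 * y5) + (z3 * w4 - z4 * w3) * (x0 * y1 - x1 * y0) + (z4 * w5 -
    z5 * w4) * (x1 * y2 - x2 * y1) + (z5 * w0 - z0 * w5) * (x2 * y3 - x3 * y2) + (z0 * w3 - z3 *
    w0 + (z1 * w4 - z4 * w1)) * (x0 * y3 - x3 * y0 + (x1 * y4 - x4 * y1)) = (z0 * x3 + z1 * x4 +
    z2 * x5 + z3 * x0 + z4 * x1 + z5 * x2 + g * e) * (w0 * y3 + w1 * y4 + w2 * y5 + w3 * y0 + w4
    * y1 + w5 * y2 + l * f) - (z0 * y3 + z1 * y4 + z2 * y5 + z3 * y0 + z4 * y1 + z5 * y2 + g * f)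
    * (w0 * x3 + w1 * x4 + w2 * x5 + w3 * x0 + w4 * x1 + w5 * x2 + l * e) := by
  linear_combination
    plucker_B (p01 := z0 * w1 - z1 * w0) (p02 := z0 * w2 - z2 * w0) (p03 := z0 * w3 - z3 * w0)
    (p04 := z0 * w4 - z4 * w0) (p05 := z0 * w5 - z5 * w0) (p07 := z0 * l - g * w0) (p12 := z1 *
    w2 - z2 * w1) (p13 := z1 * w3 - z3 * w1) (p14 := z1 * w4 - z4 * w1) (p15 := z1 * w5 - z5 *
    w1) (p17 := z1 * l - g * w1) (p23 := z2 * w3 - z3 * w2) (p24 := z2 * w4 - z4 * w2) (p25 := z2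
    * w5 - z5 * w2) (p27 := z2 * l - g * w2) (p34 := z3 * w4 - z4 * w3) (p35 := z3 * w5 - z5 *
    w3) (p37 := z3 * l - g * w3) (p45 := z4 * w5 - z5 * w4) (p47 := z4 * l - g * w4) (p57 := z5 *
    l - g * w5) (q01 := x0 * y1 - x1 * y0) (q02 := x0 * y2 - x2 * y0) (q03 := x0 * y3 - x3 * y0)
    (q04 := x0 * y4 - x4 * y0) (q05 := x0 * y5 - x5 * y0) (q07 := x0 * f - e * y0) (q12 := x1 *
    y2 - x2 * y1) (q13 := x1 * y3 - x3 * y1) (q14 := x1 * y4 - x4 * y1) (q15 := x1 * y5 - x5 *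
    y1) (q17 := x1 * f - e * y1) (q23 := x2 * y3 - x3 * y2) (q24 := x2 * y4 - x4 * y2) (q25 := x2
    * y5 - x5 * y2) (q27 := x2 * f - e * y2) (q34 := x3 * y4 - x4 * y3) (q35 := x3 * y5 - x5 *
    y3) (q37 := x3 * f - e * y3) (q45 := x4 * y5 - x5 * y4) (q47 := x4 * f - e * y4) (q57 := x5 *
    f - e * y5)
    (by linear_combination hp.d) (by linear_combination -hp.c0) (by linear_combination hp.c1) (by
    linear_combination -hp.c2) (by linear_combination hp.c3) (by linear_combination -hp.c4) (by
    linear_combination hp.c5) (by linear_combination hq.d) (by linear_combination -hq.c0) (by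
    linear_combination hq.c1) (by linear_combination -hq.c2) (by linear_combination hq.c3) (by
    linear_combination -hq.c4) (by linear_combination hq.c5)

lemma plucker_cr_fst_eq {z0 z1 z2 z3 z4 z5 g w0 w1 w2 w3 w4 w5 l x0 x1 x2 x3 x4 x5 e y0 y1 y2 y3 y4 y5 f : K}
    (hp : ReeCollinear z0 z1 z2 z3 z4 z5 g w0 w1 w2 w3 w4 w5 l) (hq : ReeCollinear x0 x1 x2 x3 x4 x5 e y0 y1 y2 y3 y4 y5 f) :
    (z5 * w0 - z0 * w5) * (x1 * y2 - x2 * y1) - (z1 * w2 - z2 * w1) * (x5 * y0 - x0 * y5) + (z0 *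
    w3 - z3 * w0 + (z1 * w4 - z4 * w1)) * (x0 * y1 - x1 * y0) - (x0 * y3 - x3 * y0 + (x1 * y4 -
    x4 * y1)) * (z0 * w1 - z1 * w0) = (w0 * x3 + w1 * x4 + w2 * x5 + w3 * x0 + w4 * x1 + w5 * x2
    + l * e) * (z0 * y1 - z1 * y0) - (z0 * x3 + z1 * x4 + z2 * x5 + z3 * x0 + z4 * x1 + z5 * x2 +
    g * e) * (w0 * y1 - w1 * y0) - (w0 * y3 + w1 * y4 + w2 * y5 + w3 * y0 + w4 * y1 + w5 * y2 + l
    * f) * (z0 * x1 - z1 * x0) + (z0 * y3 + z1 * y4 + z2 * y5 + z3 * y0 + z4 * y1 + z5 * y2 + g *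
    f) * (w0 * x1 - w1 * x0) := by
  linear_combination
    plucker_cr_fst (p01 := z0 * w1 - z1 * w0) (p02 := z0 * w2 - z2 * w0) (p03 := z0 * w3 - z3 *
    w0) (p04 := z0 * w4 - z4 * w0) (p05 := z0 * w5 - z5 * w0) (p07 := z0 * l - g * w0) (p12 := z1
    * w2 - z2 * w1) (p13 := z1 * w3 - z3 * w1) (p14 := z1 * w4 - z4 * w1) (p15 := z1 * w5 - z5 *
    w1) (p17 := z1 * l - g * w1) (q01 := x0 * y1 - x1 * y0) (q02 := x0 * y2 - x2 * y0) (q03 := x0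
    * y3 - x3 * y0) (q04 := x0 * y4 - x4 * y0) (q05 := x0 * y5 - x5 * y0) (q07 := x0 * f - e *
    y0) (q12 := x1 * y2 - x2 * y1) (q13 := x1 * y3 - x3 * y1) (q14 := x1 * y4 - x4 * y1) (q15 :=
    x1 * y5 - x5 * y1) (q17 := x1 * f - e * y1)
    (by linear_combination -hp.c0) (by linear_combination hp.c1) (by linear_combination -hq.c0)
    (by linear_combination hq.c1)

lemma plucker_cr_snd_eq {z0 z1 z2 z3 z4 z5 g w0 w1 w2 w3 w4 w5 l x0 x1 x2 x3 x4 x5 e y0 y1 y2 y3 y4 y5 f : K}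
    (hp : ReeCollinear z0 z1 z2 z3 z4 z5 g w0 w1 w2 w3 w4 w5 l) (hq : ReeCollinear x0 x1 x2 x3 x4 x5 e y0 y1 y2 y3 y4 y5 f) :
    ((z0 * w1 - z1 * w0) * (x3 * y4 - x4 * y3) - (z3 * w4 - z4 * w3) * (x0 * y1 - x1 * y0)) -
    ((z1 * w2 - z2 * w1) * (x4 * y5 - x5 * y4) - (z4 * w5 - z5 * w4) * (x1 * y2 - x2 * y1)) +
    ((z2 * w3 - z3 * w2) * (x5 * y0 - x0 * y5) - (z5 * w0 - z0 * w5) * (x2 * y3 - x3 * y2)) = (w0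
    * x3 + w1 * x4 + w2 * x5 + w3 * x0 + w4 * x1 + w5 * x2 + l * e) * (z0 * y3 - z3 * y0 + (z1 *
    y4 - z4 * y1)) - (z0 * x3 + z1 * x4 + z2 * x5 + z3 * x0 + z4 * x1 + z5 * x2 + g * e) * (w0 *
    y3 - w3 * y0 + (w1 * y4 - w4 * y1)) - (w0 * y3 + w1 * y4 + w2 * y5 + w3 * y0 + w4 * y1 + w5 *
    y2 + l * f) * (z0 * x3 - z3 * x0 + (z1 * x4 - z4 * x1)) + (z0 * y3 + z1 * y4 + z2 * y5 + z3 *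
    y0 + z4 * y1 + z5 * y2 + g * f) * (w0 * x3 - w3 * x0 + (w1 * x4 - w4 * x1)) := by
  linear_combination
    plucker_cr_snd (p01 := z0 * w1 - z1 * w0) (p02 := z0 * w2 - z2 * w0) (p03 := z0 * w3 - z3 *
    w0) (p04 := z0 * w4 - z4 * w0) (p05 := z0 * w5 - z5 * w0) (p07 := z0 * l - g * w0) (p12 := z1
    * w2 - z2 * w1) (p13 := z1 * w3 - z3 * w1) (p14 := z1 * w4 - z4 * w1) (p15 := z1 * w5 - z5 *
    w1) (p17 := z1 * l - g * w1) (p23 := z2 * w3 - z3 * w2) (p24 := z2 * w4 - z4 * w2) (p34 := z3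
    * w4 - z4 * w3) (p35 := z3 * w5 - z5 * w3) (p37 := z3 * l - g * w3) (p45 := z4 * w5 - z5 *
    w4) (p47 := z4 * l - g * w4) (q01 := x0 * y1 - x1 * y0) (q02 := x0 * y2 - x2 * y0) (q03 := x0
    * y3 - x3 * y0) (q04 := x0 * y4 - x4 * y0) (q05 := x0 * y5 - x5 * y0) (q07 := x0 * f - e *
    y0) (q12 := x1 * y2 - x2 * y1) (q13 := x1 * y3 - x3 * y1) (q14 := x1 * y4 - x4 * y1) (q15 :=
    x1 * y5 - x5 * y1) (q17 := x1 * f - e * y1) (q23 := x2 * y3 - x3 * y2) (q24 := x2 * y4 - x4 *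
    y2) (q34 := x3 * y4 - x4 * y3) (q35 := x3 * y5 - x5 * y3) (q37 := x3 * f - e * y3) (q45 := x4
    * y5 - x5 * y4) (q47 := x4 * f - e * y4)
    (by linear_combination -hp.c0) (by linear_combination hp.c1) (by linear_combination hp.c3)
    (by linear_combination -hp.c4) (by linear_combination -hq.c0) (by linear_combination hq.c1)
    (by linear_combination hq.c3) (by linear_combination -hq.c4)

variable {x0 x1 x2 x3 x4 x5 e y0 y1 y2 y3 y4 y5 f z0 z1 z2 z3 z4 z5 g : K}

omit [CharP K 3] in
lemma shift (h : ReeCollinear x0 x1 x2 x3 x4 x5 e y0 y1 y2 y3 y4 y5 f) :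
    ReeCollinear x1 x2 x3 x4 x5 x0 (-e) y1 y2 y3 y4 y5 y0 (-f) where
  c0 := by linear_combination h.c1
  c1 := by linear_combination h.c2
  c2 := by linear_combination h.c3
  c3 := by linear_combination h.c4
  c4 := by linear_combination h.c5
  c5 := by linear_combination h.c0
  d := by linear_combination -h.d

omit [CharP K 3] in
lemma row (h : ReeCollinear x0 x1 x2 x3 x4 x5 e y0 y1 y2 y3 y4 y5 f) :
    x2 ^ 2 * y4 = (x2 * x4 - e * x3) * y2 + (e * x2 - x1 * x3) * y3 + x3 ^ 2 * y1 := by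
  linear_combination x2 * h.c3 + x3 * h.c2

/-- The determinant of three rows. -/
def det (x0 x1 x2 y0 y1 y2 z0 z1 z2 : K) : K :=
  x0 * (y1 * z2 - y2 * z1) - y0 * (x1 * z2 - x2 * z1) + z0 * (x1 * y2 - x2 * y1)

omit [CharP K 3] in
lemma det_shift (h : ReeCollinear x0 x1 x2 x3 x4 x5 e y0 y1 y2 y3 y4 y5 f)
    (h' : ReeCollinear x0 x1 x2 x3 x4 x5 e z0 z1 z2 z3 z4 z5 g) :
    x2 ^ 2 * det x2 x3 x4 y2 y3 y4 z2 z3 z4 = x3 ^ 2 * det x1 x2 x3 y1 y2 y3 z1 z2 z3 := by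
  have h1 := h.row
  have h2 := h'.row
  rw [det, det]
  linear_combination (x2 * z3 - x3 * z2) * -h1 + (x2 * y3 - x3 * y2) * h2

omit [CharP K 3] in
lemma det_one_three_four (h : ReeCollinear x0 x1 x2 x3 x4 x5 e y0 y1 y2 y3 y4 y5 f)
    (h' : ReeCollinear x0 x1 x2 x3 x4 x5 e z0 z1 z2 z3 z4 z5 g) {c : K} (hx : x2 ≠ 0)
    (hc : c * x2 ^ 2 = det x1 x2 x3 y1 y2 y3 z1 z2 z3) :
    det x1 x3 x4 y1 y3 y4 z1 z3 z4 = -(x2 * x4 - e * x3) * c := by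
  have h1 := h.row
  have h2 := h'.row
  apply mul_left_cancel₀ (pow_ne_zero 2 hx)
  rw [det] at hc ⊢
  linear_combination (x1 * z3 - x3 * z1) * -h1 + (x1 * y3 - x3 * y1) * h2
    + (x2 * x4 - e * x3) * hc

omit [CharP K 3] in
lemma det_one_two_four (h : ReeCollinear x0 x1 x2 x3 x4 x5 e y0 y1 y2 y3 y4 y5 f)
    (h' : ReeCollinear x0 x1 x2 x3 x4 x5 e z0 z1 z2 z3 z4 z5 g) {c : K} (hx : x2 ≠ 0)
    (hc : c * x2 ^ 2 = det x1 x2 x3 y1 y2 y3 z1 z2 z3) :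
    det x1 x2 x4 y1 y2 y4 z1 z2 z4 = (e * x2 - x1 * x3) * c := by
  have h1 := h.row
  have h2 := h'.row
  apply mul_left_cancel₀ (pow_ne_zero 2 hx)
  rw [det] at hc ⊢
  linear_combination (x1 * z2 - x2 * z1) * -h1 + (x1 * y2 - x2 * y1) * h2
    - (e * x2 - x1 * x3) * hc

lemma det_prod (h : ReeCollinear x0 x1 x2 x3 x4 x5 e y0 y1 y2 y3 y4 y5 f)
    (h' : ReeCollinear x0 x1 x2 x3 x4 x5 e z0 z1 z2 z3 z4 z5 g) {c : K}
    (hx2 : x2 ≠ 0) (hx3 : x3 ≠ 0) (hx4 : x4 ≠ 0) (hx5 : x5 ≠ 0)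
    (hc1 : c * x2 ^ 2 = det x1 x2 x3 y1 y2 y3 z1 z2 z3)
    (hc2 : c * x3 ^ 2 = det x2 x3 x4 y2 y3 y4 z2 z3 z4)
    (hc3 : c * x4 ^ 2 = det x3 x4 x5 y3 y4 y5 z3 z4 z5)
    (hc4 : c * x5 ^ 2 = det x4 x5 x0 y4 y5 y0 z4 z5 z0)
    (hQ : e ^ 2 = x0 * x3 + x1 * x4 + x2 * x5) :
    (x0 * y1 - x1 * y0) * (x3 * z4 - x4 * z3) - (x3 * y4 - x4 * y3) * (x0 * z1 - x1 * z0)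
      + ((x1 * y2 - x2 * y1) * (x4 * z5 - x5 * z4) - (x4 * y5 - x5 * y4) * (x1 * z2 - x2 * z1))
      = -(c * e ^ 3) := by
  have a1 := det_one_three_four h h' hx2 hc1
  have a2 := det_one_three_four h.shift h'.shift hx3 hc2
  have a3 := det_one_two_four h.shift.shift h'.shift.shift hx4 hc3
  have a4 := det_one_two_four h.shift.shift.shift h'.shift.shift.shift hx5 hc4
  rw [det] at a1 a2 a3 a4
  linear_combination x1 * a3 - x0 * a1 + x2 * a4 - x1 * a2 + c * e * hQ
    + c * e * x1 * x4 * ReeField.three_eq_zero K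

end ReeCollinear

namespace ReeField

variable {K : Type*} [Field K] [CharP K 3] (R : ReeField K)

omit [CharP K 3] in
lemma collinear {X Y : R.V} (h : R.cr X Y = 0) :
    ReeCollinear X.1.1 (R.φ X.1.1) (R.φ (R.φ X.1.1)) (R.φ (R.φ (R.φ X.1.1))) (R.φ (R.φ (R.φ (R.φ X.1.1)))) (R.φ (R.φ (R.φ (R.φ (R.φ X.1.1))))) X.1.2
      Y.1.1 (R.φ Y.1.1) (R.φ (R.φ Y.1.1)) (R.φ (R.φ (R.φ Y.1.1))) (R.φ (R.φ (R.φ (R.φ Y.1.1)))) (R.φ (R.φ (R.φ (R.φ (R.φ Y.1.1))))) Y.1.2 := by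
  have h0 := R.cr_fst X Y
  rw [h, zero_fst] at h0
  have h1 := congrArg R.φ h0
  have h2 := congrArg R.φ h1
  have h3 := congrArg R.φ h2
  have h4 := congrArg R.φ h3
  have h5 := congrArg R.φ h4
  have hd := R.cr_snd X Y
  rw [h, zero_snd] at hd
  simp only [alt, map_sub, map_add, map_mul, map_neg, map_zero, φ_snd, φ_six] at h1 h2 h3 h4 h5 hd
  constructor
  · linear_combination -h0
  · linear_combination -h1
  · linear_combination -h2
  · linear_combination -h3
  · linear_combination -h4
  · linear_combination -h5
  · linear_combination -hd

lemma B_ζ_ζ (Z W X Y : R.V) (h : R.cr Z W = 0) (h' : R.cr X Y = 0) :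
    R.B (R.ζ Z W) (R.ζ X Y) = R.τk (R.B Z X * R.B W Y - R.B Z Y * R.B W X) := by
  apply Subtype.ext
  apply R.σ.injective
  have := ReeCollinear.plucker_B_eq (R.collinear h) (R.collinear h')
  simp only [coe_B, map_add, map_mul, R.σ_φ, R.σ_ζ_fst h, R.σ_ζ_snd h, R.σ_ζ_fst h', R.σ_ζ_snd h',
    σ_τk, Subfield.coe_sub, Subfield.coe_mul, pr, pr', alt, map_sub, φ_six]
  linear_combination this

lemma σ_cr_ζ_ζ_fst {Z W X Y : R.V} (h : R.cr Z W = 0) (h' : R.cr X Y = 0) :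
    R.σ (R.cr (R.ζ Z W) (R.ζ X Y)).1.1 = R.B W X * R.pr Z Y - R.B Z X * R.pr W Y
      - R.B W Y * R.pr Z X + R.B Z Y * R.pr W X := by
  have := ReeCollinear.plucker_cr_fst_eq (R.collinear h) (R.collinear h')
  simp only [coe_B, cr_fst, map_add, map_mul, R.σ_φ, R.σ_ζ_fst h, R.σ_ζ_snd h, R.σ_ζ_fst h',
    R.σ_ζ_snd h', pr, pr', alt, map_sub, φ_six]
  linear_combination this

lemma σ_cr_ζ_ζ_snd {Z W X Y : R.V} (h : R.cr Z W = 0) (h' : R.cr X Y = 0) :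
    R.σ (R.cr (R.ζ Z W) (R.ζ X Y)).1.2 = R.B W X * R.pr' Z Y - R.B Z X * R.pr' W Y
      - R.B W Y * R.pr' Z X + R.B Z Y * R.pr' W X := by
  have := ReeCollinear.plucker_cr_snd_eq (R.collinear h) (R.collinear h')
  simp only [coe_B, cr_snd, map_add, map_mul, R.σ_φ, R.σ_ζ_fst h, R.σ_ζ_fst h',
    pr, pr', alt, map_sub, φ_six]
  linear_combination this

lemma cr_ζ_ζ (Z W X Y : R.V) (h : R.cr Z W = 0) (h' : R.cr X Y = 0) (h'' : R.cr Z Y = 0)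
    (h1 : R.B Z X = 0) (h2 : R.B W Y = 0) (h3 : R.B Z Y = 0) :
    R.cr (R.ζ Z W) (R.ζ X Y) = R.τk (R.B W X) • R.ζ Z Y := by
  apply R.V_ext_σ
  · rw [R.σ_cr_ζ_ζ_fst h h', h1, h2, h3, smul_fst, map_mul, σ_τk, R.σ_ζ_fst h'']
    simp
  · rw [R.σ_cr_ζ_ζ_snd h h', h1, h2, h3, smul_snd, map_mul, σ_τk, R.σ_ζ_snd h'']
    simp

omit [CharP K 3] in
lemma eq_zero_of_fst {X W : R.V} (hX : X.1.1 ≠ 0) (h : R.cr X W = 0) (hW : W.1.1 = 0) :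
    W = 0 := by
  have h0 := R.cr_fst X W
  rw [h, hW] at h0
  simp only [zero_fst, map_zero, mul_zero, sub_zero, add_zero, zero_sub] at h0
  have : W.1.2 = 0 := by
    rcases mul_eq_zero.1 (neg_eq_zero.1 h0.symm) with h | h
    · exact h
    · exact absurd h hX
  exact R.V_ext hW this

omit [CharP K 3] in
lemma cr_self (X : R.V) : R.cr X X = 0 := by
  apply R.V_ext <;> simp only [zero_fst, zero_snd, cr_fst, cr_snd, alt, map_sub, map_mul] <;> ring

omit [CharP K 3] in
lemma exists_smul_of_fst {X Y : R.V} (hX : X ≠ 0) (h : R.cr X Y = 0) (hx : X.1.1 = 0) :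
    ∃ c : R.k, Y = c • X := by
  have he : X.1.2 ≠ 0 := fun he => hX (R.V_ext hx he)
  have h0 := R.cr_fst X Y
  rw [h, hx] at h0
  simp only [zero_fst, map_zero, mul_zero, zero_mul, sub_zero, zero_add] at h0
  have hy : Y.1.1 = 0 := (mul_eq_zero.1 h0.symm).resolve_left he
  refine ⟨⟨Y.1.2 / X.1.2, ?_⟩, ?_⟩
  · rw [mem_k, map_div₀, φ_snd, φ_snd, neg_div_neg_eq]
  · apply R.V_ext
    · rw [smul_fst, hx, hy, mul_zero]
    · rw [smul_snd]; field_simp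

omit [CharP K 3] in
lemma exists_smul_of_pr {X Y : R.V} (hX : X ≠ 0) (h : R.cr X Y = 0) (hp : R.pr X Y = 0) :
    ∃ c : R.k, Y = c • X := by
  by_cases hx : X.1.1 = 0
  · exact R.exists_smul_of_fst hX h hx
  have hx' : R.φ X.1.1 ≠ 0 := by simpa using hx
  have hk : Y.1.1 / X.1.1 ∈ R.k := by
    rw [mem_k, map_div₀, div_eq_div_iff hx' hx]
    rw [pr] at hp
    linear_combination hp
  refine ⟨⟨_, hk⟩, sub_eq_zero.1 (R.eq_zero_of_fst hx ?_ ?_)⟩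
  · rw [map_sub, map_smul, h, cr_self, smul_zero, sub_zero]
  · rw [sub_fst, smul_fst]; field_simp; ring

omit [CharP K 3] in
lemma exists_comb_of_det {X Y Z : R.V} (hx : X.1.1 ≠ 0) (h : R.cr X Y = 0) (h' : R.cr X Z = 0)
    (hp : R.pr X Y ≠ 0) (hd : ReeCollinear.det X.1.1 (R.φ X.1.1) (R.φ (R.φ X.1.1)) Y.1.1
      (R.φ Y.1.1) (R.φ (R.φ Y.1.1)) Z.1.1 (R.φ Z.1.1) (R.φ (R.φ Z.1.1)) = 0) :
    ∃ a b : R.k, Z = a • X + b • Y := by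
  have hx' : R.φ X.1.1 ≠ 0 := by simpa using hx
  have hp' : R.φ (R.pr X Y) ≠ 0 := by simpa using hp
  have hb : R.pr X Z / R.pr X Y ∈ R.k := by
    rw [mem_k, map_div₀, div_eq_div_iff hp' hp]
    simp only [pr, map_sub, map_mul]
    rw [ReeCollinear.det] at hd
    linear_combination R.φ X.1.1 * hd
  set b := R.pr X Z / R.pr X Y with hb'
  have hbp : b * R.pr X Y = R.pr X Z := by rw [hb']; field_simp
  have ha : (Z.1.1 - b * Y.1.1) / X.1.1 ∈ R.k := by
    rw [mem_k, map_div₀, div_eq_div_iff hx' hx, map_sub, map_mul, (mem_k R).1 hb]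
    simp only [pr] at hbp
    linear_combination -hbp
  refine ⟨⟨_, ha⟩, ⟨_, hb⟩, sub_eq_zero.1 (R.eq_zero_of_fst hx ?_ ?_)⟩
  · rw [map_sub, map_add, map_smul, map_smul, h, h', cr_self]; simp
  · rw [sub_fst, add_fst, smul_fst, smul_fst]; field_simp; ring

lemma ζ_eq_zero (X Y : R.V) (hX : X ≠ 0) (h : R.cr X Y = 0) (hz : R.ζ X Y = 0) :
    ∃ c : R.k, Y = c • X := by
  apply R.exists_smul_of_pr hX h
  rw [← R.σ_ζ_fst h, hz, zero_fst, map_zero]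

omit [CharP K 3] in
lemma triangle (X Y Z : R.V) (hX : X ≠ 0) (hY : ¬ ∃ c : R.k, Y = c • X) (h : R.cr X Y = 0)
    (h' : R.cr X Z = 0) (h'' : R.cr Y Z = 0) : ∃ a b : R.k, Z = a • X + b • Y := by
  by_cases hx : X.1.1 = 0
  · exact absurd (R.exists_smul_of_fst hX h hx) hY
  apply R.exists_comb_of_det hx h h' (fun hp => hY (R.exists_smul_of_pr hX h hp))
  have h1 := (R.collinear h).c1
  have h2 := (R.collinear h').c1
  have h3 := (R.collinear h'').c1
  rw [ReeCollinear.det]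
  linear_combination -R.φ X.1.1 * h3 - R.φ Z.1.1 * h1 + R.φ Y.1.1 * h2

lemma B_eq_zero_of_cr {X Y : R.V} (hX : X ≠ 0) (hXX : R.B X X = 0) (h : R.cr X Y = 0) :
    R.B X Y = 0 := by
  have h1 := R.cr_cr X X Y
  rw [h, hXX, map_zero, add_zero, zero_smul, sub_zero] at h1
  have h2 : (R.B X Y) • X = 0 := by
    have : (3 : R.k) • (R.B X Y) • X = 0 := by
      rw [show (3 : R.k) = 0 from Subtype.ext (three_eq_zero K), zero_smul]
    rw [show (3 : R.k) = 1 + 1 + 1 by norm_num, add_smul, add_smul, one_smul] at this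
    linear_combination (norm := module) this - h1
  exact (smul_eq_zero.1 h2).resolve_right hX

lemma sq_snd {X : R.V} (h : R.B X X = 0) :
    X.1.2 ^ 2 = X.1.1 * R.φ (R.φ (R.φ X.1.1)) + R.φ X.1.1 * R.φ (R.φ (R.φ (R.φ X.1.1)))
      + R.φ (R.φ X.1.1) * R.φ (R.φ (R.φ (R.φ (R.φ X.1.1)))) := by
  have h1 := congrArg Subtype.val h
  rw [coe_B] at h1
  simp only [ZeroMemClass.coe_zero] at h1
  linear_combination h1 - (X.1.1 * R.φ (R.φ (R.φ X.1.1)) + R.φ X.1.1 * R.φ (R.φ (R.φ (R.φ X.1.1)))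
      + R.φ (R.φ X.1.1) * R.φ (R.φ (R.φ (R.φ (R.φ X.1.1))))) * three_eq_zero K

lemma fst_ne_zero {X : R.V} (hX : X ≠ 0) (h : R.B X X = 0) : X.1.1 ≠ 0 := by
  intro hx
  have := R.sq_snd h
  rw [hx] at this
  simp only [map_zero, mul_zero, add_zero] at this
  exact hX (R.V_ext hx (pow_eq_zero_iff two_ne_zero |>.1 this))

lemma cr_ζ_ζ_of_isotropic {X Y Z : R.V} (hX : X ≠ 0) (hXX : R.B X X = 0)
    (h : R.cr X Y = 0) (h' : R.cr X Z = 0) : R.cr (R.ζ X Y) (R.ζ X Z) = 0 := by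
  have hXY := R.B_eq_zero_of_cr hX hXX h
  have hXZ := R.B_eq_zero_of_cr hX hXX h'
  apply R.V_ext_σ
  · rw [R.σ_cr_ζ_ζ_fst h h', R.B_symm Y X, hXX, hXY, hXZ, zero_fst, map_zero, pr, pr, pr, pr,
      ZeroMemClass.coe_zero]
    ring
  · rw [R.σ_cr_ζ_ζ_snd h h', R.B_symm Y X, hXX, hXY, hXZ, zero_snd, map_zero, pr', pr', pr', pr',
      alt, alt, alt, alt, ZeroMemClass.coe_zero]
    simp only [map_sub, map_mul]
    ring

lemma ζ_ζ_ζ (X Y Z : R.V) (hX : X ≠ 0) (hXX : R.B X X = 0) (h : R.cr X Y = 0)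
    (h' : R.cr X Z = 0) :
    ∃ c : R.k, R.ζ (R.ζ X Y) (R.ζ X Z) = c • X ∧
      (c = 0 → (∃ a : R.k, Y = a • X) ∨ ∃ a b : R.k, Z = a • X + b • Y) := by
  have hx := R.fst_ne_zero hX hXX
  have hQ := R.sq_snd hXX
  have hx1 : R.φ X.1.1 ≠ 0 := by simpa using hx
  have hx2 : R.φ (R.φ X.1.1) ≠ 0 := by simpa using hx
  have hx3 : R.φ (R.φ (R.φ X.1.1)) ≠ 0 := by simpa using hx
  have hx4 : R.φ (R.φ (R.φ (R.φ X.1.1))) ≠ 0 := by simpa using hx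
  have hx5 : R.φ (R.φ (R.φ (R.φ (R.φ X.1.1)))) ≠ 0 := by simpa using hx
  set D := ReeCollinear.det X.1.1 (R.φ X.1.1) (R.φ (R.φ X.1.1)) Y.1.1
      (R.φ Y.1.1) (R.φ (R.φ Y.1.1)) Z.1.1 (R.φ Z.1.1) (R.φ (R.φ Z.1.1)) with hD
  have hc : D / R.φ X.1.1 ^ 2 ∈ R.k := by
    rw [mem_k, map_div₀, div_eq_div_iff (by simpa using hx) (by simpa using hx), map_pow]
    have h1 := (R.collinear h).shift.shift.shift.shift.shift.det_shift
      (R.collinear h').shift.shift.shift.shift.shift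
    rw [hD, ReeCollinear.det] at *
    rw [ReeCollinear.det] at h1
    simp only [map_add, map_sub, map_mul]
    linear_combination h1
  obtain ⟨c, hcD⟩ : ∃ c : R.k, (c : K) = D / R.φ X.1.1 ^ 2 := ⟨⟨_, hc⟩, rfl⟩
  have hc0 : c * R.φ X.1.1 ^ 2 = D := by rw [hcD]; field_simp
  have hc1 := congrArg R.φ hc0
  rw [hD, ReeCollinear.det] at hc1
  simp only [map_add, map_sub, map_mul, map_pow, R.φ_k] at hc1
  have hc2 := congrArg R.φ hc1
  simp only [map_add, map_sub, map_mul, map_pow, R.φ_k] at hc2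
  have hc3 := congrArg R.φ hc2
  simp only [map_add, map_sub, map_mul, map_pow, R.φ_k] at hc3
  have hc4 := congrArg R.φ hc3
  simp only [map_add, map_sub, map_mul, map_pow, R.φ_k, φ_six] at hc4
  have key := ReeCollinear.det_prod (R.collinear h) (R.collinear h') hx2 hx3 hx4 hx5 hc1 hc2 hc3
    hc4 hQ
  have hcr := R.cr_ζ_ζ_of_isotropic hX hXX h h'
  refine ⟨R.τk (R.τk c), ?_, fun h0 => ?_⟩
  · apply R.V_ext_σ <;> apply R.σ.injective
    · rw [R.σ_ζ_fst hcr, smul_fst, map_mul, map_mul, σ_τk, σ_τk, R.σ_σ, pr, map_sub, map_mul, map_mul,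
        R.σ_φ, R.σ_φ, R.σ_ζ_fst h, R.σ_ζ_fst h', pr, pr]
      simp only [map_sub, map_mul]
      rw [hD, ReeCollinear.det] at hc0
      linear_combination -R.φ X.1.1 * hc0
    · rw [R.σ_ζ_snd hcr, smul_snd, map_mul, map_mul, σ_τk, σ_τk, R.σ_σ, pr', alt]
      simp only [map_sub, map_add, map_mul, R.σ_φ, R.σ_ζ_fst h, R.σ_ζ_fst h', pr, R.φ_snd]
      linear_combination key
  · have hc' : c = 0 := by simpa using h0
    rw [hc', ZeroMemClass.coe_zero, zero_mul] at hc0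
    by_cases hp : R.pr X Y = 0
    · exact Or.inl (R.exists_smul_of_pr hX h hp)
    · exact Or.inr (R.exists_comb_of_det hx h h' hp hc0.symm)

/-- The Ree hexagon of a field. -/
noncomputable def hexagon (h : 7 ≤ Module.finrank R.k R.V) : ReeHexagon R.k R.V where
  B := R.B
  cr := R.cr
  ζ := R.ζ
  τ := R.τk
  C := 1
  D := 1
  two_ne := fun h => by
    have h3 : (3 : R.k) = 0 := Subtype.ext (three_eq_zero K)
    exact one_ne_zero (α := R.k) (by linear_combination h3 - h)
  C_ne := one_ne_zero
  D_ne := one_ne_zero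
  B_symm := R.B_symm
  cr_swap := R.cr_swap
  cr_cr := R.cr_cr
  ζ_self := R.ζ_self
  ζ_swap := R.ζ_swap
  ζ_lin := R.ζ_lin
  ζ_eq_zero := R.ζ_eq_zero
  triangle := R.triangle
  B_ζ_ζ Z W X Y h h' := by rw [one_mul]; exact R.B_ζ_ζ Z W X Y h h'
  cr_ζ_ζ Z W X Y h h' h'' h1 h2 h3 := by rw [one_mul]; exact R.cr_ζ_ζ Z W X Y h h' h'' h1 h2 h3
  ζ_ζ_ζ := R.ζ_ζ_ζ
  seven_le := h

end ReeField

open Finset Polynomial in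
lemma card_filter_le_of_degree_lt {K : Type*} [Field K] [Fintype K] [DecidableEq K] (S : Finset K)
    {n : ℕ} (r : K[X]) (hr : r ∈ degreeLT K n) (h : ∀ x ∈ S, x ^ n + r.eval x = 0) : #S ≤ n := by
  have hr' := mem_degreeLT.1 hr
  have hm : (X ^ n + r).Monic := monic_X_pow_add hr'
  have hd : (X ^ n + r).natDegree = n := by
    have := degree_add_eq_left_of_degree_lt (p := (X : K[X]) ^ n) (q := r) (by simpa using hr')
    rw [natDegree, this]; simp
  rw [← hd]
  apply card_le_degree_of_subset_roots
  intro x hx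
  rw [mem_roots hm.ne_zero]
  simpa using h x hx

open Polynomial in
lemma X_pow_mem_degreeLT {K : Type*} [Field K] {m n : ℕ} (h : m < n) :
    (X : K[X]) ^ m ∈ degreeLT K n := by
  rw [mem_degreeLT, degree_X_pow]; exact_mod_cast h

open Finset in
lemma card_fiber_eq {α β : Type*} [DecidableEq β] (S : Finset α) (T : Finset β) (f : α → β)
    {a b : ℕ} (hf : ∀ x ∈ S, f x ∈ T) (hT : #T ≤ b) (hfib : ∀ c ∈ T, #{x ∈ S | f x = c} ≤ a)
    (hS : #S = a * b) (ha : 0 < a) : #T = b ∧ ∀ c ∈ T, #{x ∈ S | f x = c} = a := by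
  have h1 := card_eq_sum_card_fiberwise hf
  have h2 : ∑ c ∈ T, #{x ∈ S | f x = c} ≤ ∑ c ∈ T, a := sum_le_sum hfib
  have h3 : ∑ c ∈ T, a = #T * a := by simp
  have hb : #T = b := by
    apply le_antisymm hT
    rw [← h1, hS, h3, mul_comm] at h2
    exact Nat.le_of_mul_le_mul_right h2 ha
  refine ⟨hb, (sum_eq_sum_iff_of_le hfib).1 ?_⟩
  rw [← h1, hS, h3, hb, mul_comm]

namespace ReeField

open Finset Polynomial

variable {K : Type*} [Field K] [Fintype K] [DecidableEq K] {q : ℕ}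

lemma card_sub_fiber (hK : Fintype.card K = q ^ 6) (hq : 1 < q) {φ : K →+* K}
    (hφ : ∀ x, φ x = x ^ q) (hφ6 : ∀ x, φ (φ (φ (φ (φ (φ x))))) = x) {c : K}
    (hc : c + φ c + φ (φ c) + φ (φ (φ c)) + φ (φ (φ (φ c))) + φ (φ (φ (φ (φ c)))) = 0) :
    #{x : K | φ x - x = c} = q := by
  have hlt {m n : ℕ} (h : m < n) : q ^ m < q ^ n := Nat.pow_lt_pow_right hq h
  have := card_fiber_eq (univ : Finset K) {c : K | c + φ c + φ (φ c) + φ (φ (φ c))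
    + φ (φ (φ (φ c))) + φ (φ (φ (φ (φ c)))) = 0} (fun x => φ x - x) (a := q) (b := q ^ 5)
    (fun x _ => by
      simp only [mem_filter, mem_univ, true_and, map_sub, hφ6]; ring)
    (by
      apply card_filter_le_of_degree_lt _ (X ^ (q ^ 0) + X ^ (q ^ 1) + X ^ (q ^ 2) + X ^ (q ^ 3)
        + X ^ (q ^ 4))
      · refine add_mem (add_mem (add_mem (add_mem ?_ ?_) ?_) ?_) ?_ <;>
          exact X_pow_mem_degreeLT (hlt (by norm_num))
      · intro x hx
        simp only [mem_filter, mem_univ, true_and, hφ, ← pow_mul] at hx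
        simp only [eval_add, eval_pow, eval_X]
        rw [← hx]; ring)
    (fun c _ => by
      apply card_filter_le_of_degree_lt _ (-X ^ 1 - C c)
      · refine sub_mem (neg_mem (X_pow_mem_degreeLT hq)) ?_
        rw [mem_degreeLT]
        exact degree_C_le.trans_lt (by exact_mod_cast (by omega : 0 < q))
      · intro x hx
        simp only [mem_filter, mem_univ, true_and, hφ] at hx
        simp only [eval_sub, eval_neg, eval_pow, eval_X, eval_C]
        rw [← hx]; ring)
    (by rw [card_univ, hK]; ring) (by omega)
  simpa using this.2 c (by simpa using hc)

lemma card_neg (hK : Fintype.card K = q ^ 6) (hq : 1 < q) {φ : K →+* K}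
    (hφ : ∀ x, φ x = x ^ q) (hφ6 : ∀ x, φ (φ (φ (φ (φ (φ x))))) = x) :
    #{x : K | φ x = -x} = q := by
  have hlt {m n : ℕ} (h : m < n) : q ^ m < q ^ n := Nat.pow_lt_pow_right hq h
  have := card_fiber_eq (univ : Finset K) {c : K | -c + φ c - φ (φ c) + φ (φ (φ c))
    - φ (φ (φ (φ c))) + φ (φ (φ (φ (φ c)))) = 0} (fun x => φ x + x) (a := q) (b := q ^ 5)
    (fun x _ => by
      simp only [mem_filter, mem_univ, true_and, map_add, hφ6]; ring)
    (by
      apply card_filter_le_of_degree_lt _ (-X ^ (q ^ 0) + X ^ (q ^ 1) - X ^ (q ^ 2) + X ^ (q ^ 3)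
        - X ^ (q ^ 4))
      · refine sub_mem (add_mem (sub_mem (add_mem (neg_mem ?_) ?_) ?_) ?_) ?_ <;>
          exact X_pow_mem_degreeLT (hlt (by norm_num))
      · intro x hx
        simp only [mem_filter, mem_univ, true_and, hφ, ← pow_mul] at hx
        simp only [eval_add, eval_sub, eval_neg, eval_pow, eval_X]
        rw [← hx]; ring)
    (fun c _ => by
      apply card_filter_le_of_degree_lt _ (X ^ 1 - C c)
      · refine sub_mem (X_pow_mem_degreeLT hq) ?_
        rw [mem_degreeLT]
        exact degree_C_le.trans_lt (by exact_mod_cast (by omega : 0 < q))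
      · intro x hx
        simp only [mem_filter, mem_univ, true_and, hφ] at hx
        simp only [eval_sub, eval_pow, eval_X, eval_C]
        rw [← hx]; ring)
    (by rw [card_univ, hK]; ring) (by omega)
  have h0 := this.2 0 (by simp)
  simpa [eq_neg_iff_add_eq_zero] using h0

lemma card_norm_fiber (hK : Fintype.card K = q ^ 6) (hq : 1 < q) {φ : K →+* K}
    (hφ : ∀ x, φ x = x ^ q) (hφ6 : ∀ x, φ (φ (φ (φ (φ (φ x))))) = x) :
    #{c : K | φ (φ (φ c)) = c} = q ^ 3 ∧ ∀ c, c ≠ 0 → φ (φ (φ c)) = c →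
    #{x : K | x * φ (φ (φ x)) = c} = q ^ 3 + 1 := by
  have h3 (x : K) : φ (φ (φ x)) = x ^ q ^ 3 := by
    simp only [hφ, ← pow_mul]; congr 1; ring
  obtain ⟨m, hm⟩ : ∃ m, q ^ 3 = m + 1 := ⟨q ^ 3 - 1, by have : 0 < q ^ 3 := by positivity
                                                        omega⟩
  have hm0 : 1 < q ^ 3 := Nat.one_lt_pow (by norm_num) hq
  have h := card_fiber_eq (univ.erase (0 : K)) {c : K | φ (φ (φ c)) = c ∧ c ≠ 0}
    (fun x => x * φ (φ (φ x))) (a := q ^ 3 + 1) (b := m)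
    (fun x hx => by
      have : x ≠ 0 := by simpa using hx
      simp only [mem_filter, mem_univ, true_and, map_mul, hφ6]
      exact ⟨mul_comm _ _, by simpa using this⟩)
    (by
      apply card_filter_le_of_degree_lt _ (- C 1)
      · refine neg_mem ?_
        rw [mem_degreeLT]
        exact degree_C_le.trans_lt (by exact_mod_cast (by omega : 0 < m))
      · intro x hx
        simp only [mem_filter, mem_univ, true_and, h3, hm] at hx
        simp only [eval_neg, eval_C]
        apply mul_right_cancel₀ hx.2
        rw [pow_succ] at hx
        linear_combination hx.1)
    (fun c _ => by
      apply card_filter_le_of_degree_lt _ (- C c)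
      · refine neg_mem ?_
        rw [mem_degreeLT]
        exact degree_C_le.trans_lt (by exact_mod_cast (by omega : 0 < q ^ 3 + 1))
      · intro x hx
        simp only [mem_filter, h3] at hx
        simp only [eval_neg, eval_C]
        rw [← hx.2]; ring)
    (by
      rw [card_erase_of_mem (mem_univ _), card_univ, hK, show q ^ 6 = (q ^ 3) ^ 2 by ring, hm]
      rw [Nat.sub_eq_iff_eq_add (by nlinarith)]
      ring) (by omega)
  constructor
  · have : ({c : K | φ (φ (φ c)) = c} : Finset K) = insert 0 ({c : K | φ (φ (φ c)) = c ∧ c ≠ 0} :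
        Finset K) := by
      ext x
      by_cases hx : x = 0 <;> simp [hx]
    rw [this, card_insert_of_notMem (by simp), h.1, hm]
  · intro c hc hc'
    rw [← h.2 c (by simp [hc, hc'])]
    congr 1
    ext x
    simp only [mem_filter, mem_univ, true_and, mem_erase, and_true]
    refine ⟨fun hx => ⟨fun h0 => hc ?_, hx⟩, fun hx => hx.2⟩
    rw [← hx, h0, zero_mul]

lemma card_trace_fiber (hq : 1 < q) {φ : K →+* K} (hφ : ∀ x, φ x = x ^ q)
    (hE : #{c : K | φ (φ (φ c)) = c} = q ^ 3) {c : K} (hc : φ c = c) :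
    #{x ∈ ({c : K | φ (φ (φ c)) = c} : Finset K) | x + φ x + φ (φ x) = c} = q ^ 2 := by
  have hlt {m n : ℕ} (h : m < n) : q ^ m < q ^ n := Nat.pow_lt_pow_right hq h
  have h := card_fiber_eq ({c : K | φ (φ (φ c)) = c} : Finset K) {c : K | φ c = c}
    (fun x => x + φ x + φ (φ x)) (a := q ^ 2) (b := q)
    (fun x hx => by
      simp only [mem_filter, mem_univ, true_and, map_add] at hx ⊢
      rw [hx]; ring)
    (by
      apply card_filter_le_of_degree_lt _ (- X ^ 1)
      · exact neg_mem (X_pow_mem_degreeLT hq)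
      · intro x hx
        simp only [mem_filter, mem_univ, true_and, hφ] at hx
        simp only [eval_neg, eval_pow, eval_X, hx]
        ring)
    (fun c _ => by
      apply card_filter_le_of_degree_lt _ (X ^ (q ^ 0) + X ^ (q ^ 1) - C c)
      · refine sub_mem (add_mem ?_ ?_) ?_
        · exact X_pow_mem_degreeLT (hlt (by norm_num))
        · exact X_pow_mem_degreeLT (hlt (by norm_num))
        rw [mem_degreeLT]
        exact degree_C_le.trans_lt (by exact_mod_cast (by positivity : 0 < q ^ 2))
      · intro x hx
        simp only [mem_filter, mem_univ, true_and, hφ, ← pow_mul] at hx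
        simp only [eval_add, eval_sub, eval_pow, eval_X, eval_C]
        rw [← hx.2]; ring)
    (by rw [hE]; ring) (by positivity)
  exact h.2 c (by simpa using hc)

/-- The number of vectors of given twisted norm. -/
lemma card_norm_trace (hK : Fintype.card K = q ^ 6) (hq : 1 < q) {φ : K →+* K}
    (hφ : ∀ x, φ x = x ^ q) (hφ6 : ∀ x, φ (φ (φ (φ (φ (φ x))))) = x) {c : K} (hc : φ c = c) :
    (#{x : K | x * φ (φ (φ x)) + φ (x * φ (φ (φ x))) + φ (φ (x * φ (φ (φ x)))) = c} : ℤ)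
      = q ^ 2 * (q ^ 3 + 1) - if c = 0 then (q : ℤ) ^ 3 else 0 := by
  obtain ⟨hE, hn⟩ := card_norm_fiber hK hq hφ hφ6
  have ht := card_trace_fiber hq hφ hE hc
  set T := ({x ∈ ({c : K | φ (φ (φ c)) = c} : Finset K) | x + φ x + φ (φ x) = c} : Finset K)
    with hT
  have h1 : #{x : K | x * φ (φ (φ x)) + φ (x * φ (φ (φ x))) + φ (φ (x * φ (φ (φ x)))) = c} =
      ∑ n ∈ T, #{x : K | x * φ (φ (φ x)) = n} := by
    rw [card_eq_sum_card_fiberwise (f := fun x => x * φ (φ (φ x))) (t := T)]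
    · apply sum_congr rfl
      intro n hn
      congr 1
      ext x
      simp only [hT, mem_filter, mem_univ, true_and] at hn ⊢
      exact ⟨fun h => h.2, fun h => ⟨by rw [h, hn.2], h⟩⟩
    · intro x hx
      simp only [hT, mem_coe, mem_filter, mem_univ, true_and, map_mul, hφ6] at hx ⊢
      exact ⟨mul_comm _ _, hx⟩
  have h2 : ∀ n ∈ T, (#{x : K | x * φ (φ (φ x)) = n} : ℤ) =
      (q ^ 3 + 1) - if n = 0 then (q : ℤ) ^ 3 else 0 := by
    intro n hn'
    split_ifs with h0
    · have : ({x : K | x * φ (φ (φ x)) = n} : Finset K) = {0} := by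
        ext x; simp [h0]
      rw [this]; simp
    · rw [hn n h0 (by simp only [hT, mem_filter] at hn'; exact hn'.1.2)]; simp
  rw [h1, Nat.cast_sum, sum_congr rfl h2, sum_sub_distrib, sum_const, ht, sum_ite_eq']
  have : (0 : K) ∈ T ↔ c = 0 := by simp [hT, eq_comm]
  simp [this]

end ReeField

namespace ReeField

open Finset

variable {K : Type*} [Field K] [Fintype K] {q : ℕ} (R : ReeField K)

lemma card_k (hK : Fintype.card K = q ^ 6) (hq : 1 < q) (hφ : ∀ x, R.φ x = x ^ q) :
    Nat.card R.k = q := by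
  classical
  have h := card_sub_fiber hK hq hφ R.φ_six (c := 0) (by simp)
  rw [← h, Nat.card_congr (Equiv.refl {x : K // x ∈ R.k}), Nat.card_eq_fintype_card,
    Fintype.card_subtype]
  congr 1
  ext x
  simp [mem_k, sub_eq_zero]

/-- The coordinates of a vector. -/
def equivV : R.V ≃ {e : K // R.φ e = -e} × K where
  toFun X := (⟨X.1.2, X.2⟩, X.1.1)
  invFun p := ⟨(p.2, p.1.1), p.1.2⟩
  left_inv _ := rfl
  right_inv _ := rfl

lemma card_eigen (hK : Fintype.card K = q ^ 6) (hq : 1 < q) (hφ : ∀ x, R.φ x = x ^ q) :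
    Nat.card {e : K // R.φ e = -e} = q := by
  classical
  rw [Nat.card_eq_fintype_card, Fintype.card_subtype, card_neg hK hq hφ R.φ_six]

lemma finrank_V (hK : Fintype.card K = q ^ 6) (hq : 1 < q) (hφ : ∀ x, R.φ x = x ^ q) :
    Module.finrank R.k R.V = 7 := by
  have h1 := Module.natCard_eq_pow_finrank (K := R.k) (V := R.V)
  rw [R.card_k hK hq hφ, Nat.card_congr R.equivV, Nat.card_prod, R.card_eigen hK hq hφ,
    Nat.card_eq_fintype_card (α := K), hK, ← pow_succ'] at h1
  exact (Nat.pow_right_injective hq h1).symm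

variable [CharP K 3]

lemma card_isotropic (hK : Fintype.card K = q ^ 6) (hq : 1 < q) (hφ : ∀ x, R.φ x = x ^ q) :
    Nat.card {X : R.V // R.B X X = 0} = q ^ 6 := by
  classical
  have e1 : {X : R.V // R.B X X = 0} ≃ (e : {e : K // R.φ e = -e}) ×
      {x : K // x * R.φ (R.φ (R.φ x)) + R.φ (x * R.φ (R.φ (R.φ x)))
        + R.φ (R.φ (x * R.φ (R.φ (R.φ x)))) = e ^ 2} :=
    { toFun := fun X => ⟨⟨X.1.1.2, X.1.2⟩, ⟨X.1.1.1, by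
        rw [R.sq_snd X.2]; simp only [map_mul]⟩⟩
      invFun := fun p => ⟨⟨(p.2.1, p.1.1), p.1.2⟩, by
        apply Subtype.ext
        have h := p.2.2
        simp only [map_mul] at h
        rw [coe_B, ZeroMemClass.coe_zero]
        linear_combination 2 * h + p.1.1 ^ 2 * three_eq_zero K⟩
      left_inv := fun _ => rfl
      right_inv := fun _ => rfl }
  rw [Nat.card_congr e1, Nat.card_sigma]
  have h2 : ∀ e : {e : K // R.φ e = -e}, (Nat.card {x : K // x * R.φ (R.φ (R.φ x)) +
      R.φ (x * R.φ (R.φ (R.φ x))) + R.φ (R.φ (x * R.φ (R.φ (R.φ x)))) = e ^ 2} : ℤ) =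
      q ^ 2 * (q ^ 3 + 1) - if e = ⟨0, by simp⟩ then (q : ℤ) ^ 3 else 0 := by
    intro e
    rw [Nat.card_eq_fintype_card, Fintype.card_subtype, card_norm_trace hK hq hφ R.φ_six
      (by rw [map_pow, e.2, neg_sq])]
    simp [Subtype.ext_iff]
  have h3 := R.card_eigen hK hq hφ
  rw [Nat.card_eq_fintype_card] at h3
  zify
  rw [sum_congr rfl fun e _ => h2 e, sum_sub_distrib, sum_const, card_univ, h3, sum_ite_eq']
  simp only [mem_univ, if_true]
  ring

lemma card_isotropic_ne_zero (hK : Fintype.card K = q ^ 6) (hq : 1 < q)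
    (hφ : ∀ x, R.φ x = x ^ q) :
    Nat.card {X : R.V // X ≠ 0 ∧ R.B X X = 0} = q ^ 6 - 1 := by
  classical
  have h := R.card_isotropic hK hq hφ
  rw [Nat.card_eq_fintype_card, Fintype.card_subtype] at h ⊢
  rw [← h, ← card_erase_of_mem (s := ({X | R.B X X = 0} : Finset R.V)) (a := 0) (by simp)]
  congr 1
  ext X
  simp

lemma card_isLoop (hK : Fintype.card K = q ^ 6) (hq : 1 < q) (hφ : ∀ x, R.φ x = x ^ q)
    (h7 : 7 ≤ Module.finrank R.k R.V) :
    Nat.card {X : R.V // (R.hexagon h7).IsLoop X} = (q - 1) * (q ^ 3 + 1) := by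
  have h := (R.hexagon h7).card_loops
  have h' : Nat.card {X : R.V // X ≠ 0 ∧ (R.hexagon h7).B X X = 0} = q ^ 6 - 1 :=
    R.card_isotropic_ne_zero hK hq hφ
  rw [R.card_k hK hq hφ, h'] at h
  have h1 : 1 < q ^ 3 := Nat.one_lt_pow (by norm_num) hq
  have h2 : q ^ 6 - 1 = (q ^ 3 + 1) * (q ^ 3 - 1) := by
    obtain ⟨m, hm⟩ := Nat.exists_eq_add_of_lt h1
    rw [show q ^ 6 = (q ^ 3) ^ 2 by ring, hm, Nat.sub_eq_iff_eq_add (by nlinarith),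
      show 1 + m + 1 - 1 = m + 1 by omega]
    ring
  apply Nat.eq_of_mul_eq_mul_right (show 0 < q ^ 3 - 1 by omega)
  rw [h, h2]
  ring

end ReeField

namespace ReeField

section

variable {K : Type*} [Field K]

lemma coefficient_identity_zero [CharP K 3] {a1 a2 a3 a4 a5 V0 V1 V2 V3 V4 V5 : K}
    (h0 : V0 + V1 + V2 + V3 + V4 + V5 = 0)
    (h1 : V1 * a1 + V2 * a2 + V3 * a3 + V4 * a4 + V5 * a5 = 0)
    (h2 : V1 * a1 ^ 2 + V2 * a2 ^ 2 + V3 * a3 ^ 2 + V4 * a4 ^ 2 + V5 * a5 ^ 2 = 0)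
    (h3 : V1 * a1 ^ 3 + V2 * a2 ^ 3 + V3 * a3 ^ 3 + V4 * a4 ^ 3 + V5 * a5 ^ 3 = 0)
    (hS : a2 ^ 3 * ((V1 + V2) ^ 2 - (V1) ^ 2) + a3 ^ 3 * ((V1 + V2 + V3) ^ 2 - (V1 + V2) ^ 2) +
    a4 ^ 3 * ((V1 + V2 + V3 + V4) ^ 2 - (V1 + V2 + V3) ^ 2) + a5 ^ 3 * ((V1 + V2 + V3 + V4 + V5)
    ^ 2 - (V1 + V2 + V3 + V4) ^ 2) + a1 ^ 3 * V1 ^ 2 = 0) :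
    (a1 + (a2 - a1)) ^ 2 * (a3 - a2) * (-a5) * V2 * V0 + a1 ^ 2 * ((a2 - a1) + (a3 - a2)) * (-a5)
    * V1 * V0 + (a2 - a1) ^ 2 * (a1 + -a5) * (a3 - a2) * V1 * V2 = 0 := by
  have key :
    (a1 + (a2 - a1)) ^ 2 * (a3 - a2) * (-a5) * V2 * V0 + a1 ^ 2 * ((a2 - a1) + (a3 - a2)) * (-a5)
    * V1 * V0 + (a2 - a1) ^ 2 * (a1 + -a5) * (a3 - a2) * V1 * V2 -
      ((V1 * a1 * a3 * a5 ^ 2 - V1 * a1 * a4 * a5 ^ 2 - V1 * a1 * a5 ^ 3 + V1 * a1 ^ 2 * a4 * a5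
      + V2 * a2 * a3 * a5 ^ 2 - V2 * a2 * a4 * a5 ^ 2 - V2 * a2 * a5 ^ 3 + V2 * a2 ^ 2 * a4 * a5
      - V3 * a3 * a4 * a5 ^ 2 - V3 * a3 * a5 ^ 3 + V3 * a3 ^ 2 * a4 * a5 + V3 * a3 ^ 2 * a5 ^ 2 +
      V4 * a3 * a4 * a5 ^ 2 + V4 * a3 * a4 ^ 2 * a5 - V4 * a4 * a5 ^ 3 - V4 * a4 ^ 2 * a5 ^ 2 -
      V5 * a3 * a5 ^ 3 + V5 * a5 ^ 4) * (V0 + V1 + V2 + V3 + V4 + V5) +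
      (-V0 * a3 * a5 ^ 2 + V0 * a4 * a5 ^ 2 + V0 * a5 ^ 3 + V1 * a1 * a3 * a5 - V1 * a1 ^ 2 * a4
      - V1 * a1 ^ 2 * a5 - V1 * a3 * a5 ^ 2 + V1 * a4 * a5 ^ 2 + V1 * a5 ^ 3 + V2 * a2 * a3 * a5
      - V2 * a2 ^ 2 * a4 - V2 * a2 ^ 2 * a5 - V2 * a3 * a5 ^ 2 + V2 * a4 * a5 ^ 2 + V2 * a5 ^ 3 -
      V3 * a3 * a5 ^ 2 - V3 * a3 ^ 2 * a4 + V3 * a4 * a5 ^ 2 + V3 * a5 ^ 3 - V4 * a3 * a4 * a5 -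
      V4 * a3 * a4 ^ 2 - V4 * a3 * a5 ^ 2 + V4 * a4 * a5 ^ 2 + V4 * a4 ^ 2 * a5 + V4 * a5 ^ 3) *
      (V1 * a1 + V2 * a2 + V3 * a3 + V4 * a4 + V5 * a5) +
      (-V0 * a3 * a5 - V0 * a4 * a5 + V1 * a1 * a3 + V1 * a1 * a4 - V1 * a1 * a5 + V1 * a1 ^ 2 -
      V1 * a3 * a5 - V1 * a4 * a5 + V2 * a2 * a3 + V2 * a2 * a4 - V2 * a2 * a5 + V2 * a2 ^ 2 - V2
      * a3 * a5 - V2 * a4 * a5 + V3 * a3 * a4 + V3 * a3 * a5 - V3 * a3 ^ 2 - V3 * a4 * a5) * (V1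
      * a1 ^ 2 + V2 * a2 ^ 2 + V3 * a3 ^ 2 + V4 * a4 ^ 2 + V5 * a5 ^ 2) +
      (V0 * a5 - V1 * a1 + V1 * a3 - V2 * a2 + V2 * a3) * (V1 * a1 ^ 3 + V2 * a2 ^ 3 + V3 * a3 ^
      3 + V4 * a4 ^ 3 + V5 * a5 ^ 3) +
      (a3 - a5) * (a2 ^ 3 * ((V1 + V2) ^ 2 - (V1) ^ 2) + a3 ^ 3 * ((V1 + V2 + V3) ^ 2 - (V1 + V2)
      ^ 2) + a4 ^ 3 * ((V1 + V2 + V3 + V4) ^ 2 - (V1 + V2 + V3) ^ 2) + a5 ^ 3 * ((V1 + V2 + V3 +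
      V4 + V5) ^ 2 - (V1 + V2 + V3 + V4) ^ 2) + a1 ^ 3 * V1 ^ 2)) = 0 := by
    clear h0 h1 h2 h3 hS
    grind
  rw [h0, h1, h2, h3, hS] at key
  linear_combination key

lemma coefficient_identity [CharP K 3] {a0 a1 a2 a3 a4 a5 A0 A1 A2 A3 A4 A5 : K}
    (h1 : (A1 - A0) * a1 + (A2 - A1) * a2 + (A3 - A2) * a3 + (A4 - A3) * a4 + (A5 - A4) * a5 +
    (A0 - A5) * a0 = 0)
    (h2 : (A1 - A0) * a1 ^ 2 + (A2 - A1) * a2 ^ 2 + (A3 - A2) * a3 ^ 2 + (A4 - A3) * a4 ^ 2 + (A5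
    - A4) * a5 ^ 2 + (A0 - A5) * a0 ^ 2 = 0)
    (h3 : (A1 - A0) * a1 ^ 3 + (A2 - A1) * a2 ^ 3 + (A3 - A2) * a3 ^ 3 + (A4 - A3) * a4 ^ 3 + (A5
    - A4) * a5 ^ 3 + (A0 - A5) * a0 ^ 3 = 0)
    (hS : a1 ^ 3 * (A1 ^ 2 - A0 ^ 2) + a2 ^ 3 * (A2 ^ 2 - A1 ^ 2) + a3 ^ 3 * (A3 ^ 2 - A2 ^ 2) +
    a4 ^ 3 * (A4 ^ 2 - A3 ^ 2) + a5 ^ 3 * (A5 ^ 2 - A4 ^ 2) + a0 ^ 3 * (A0 ^ 2 - A5 ^ 2) = 0) :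
    (a2 - a0) ^ 2 * (a3 - a2) * (a0 - a5) * (A2 - A1) * (A0 - A5) + (a1 - a0) ^ 2 * (a3 - a1) *
    (a0 - a5) * (A1 - A0) * (A0 - A5) + (a2 - a1) ^ 2 * (a1 - a5) * (a3 - a2) * (A1 - A0) * (A2 -
    A1) = 0 := by
  have key := coefficient_identity_zero (a1 := a1 - a0) (a2 := a2 - a0) (a3 := a3 - a0) (a4 := a4 - a0) (a5 := a5 - a0)
      (V0 := A0 - A5) (V1 := A1 - A0) (V2 := A2 - A1) (V3 := A3 - A2) (V4 := A4 - A3) (V5 := A5 - A4)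
      (by ring) (by linear_combination h1) (by linear_combination h2 - 2 * a0 * h1)
      (by linear_combination h3 - 3 * a0 * h2 + 3 * a0 ^ 2 * h1)
      (by linear_combination hS - 2 * A0 * h3 + (
        (a1 * a0 ^ 2 - a1 ^ 2 * a0) * ((A1 - A0) ^ 2 - (A0 - A0) ^ 2) + (a2 * a0 ^ 2 - a2 ^ 2 *
        a0) * ((A2 - A0) ^ 2 - (A1 - A0) ^ 2) + (a3 * a0 ^ 2 - a3 ^ 2 * a0) * ((A3 - A0) ^ 2 -
        (A2 - A0) ^ 2) + (a4 * a0 ^ 2 - a4 ^ 2 * a0) * ((A4 - A0) ^ 2 - (A3 - A0) ^ 2) + (a5 * a0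
        ^ 2 - a5 ^ 2 * a0) * ((A5 - A0) ^ 2 - (A4 - A0) ^ 2)) * three_eq_zero K)
  linear_combination key

lemma mul_add_mul_eq {u v g U b c : K} (hb : u * b = 1) (hc : v * c = 1) (hg : g * u * v * U = 1) :
    g * (u + v) * U = b + c := by
  linear_combination (b + c) * hg - g * U * v * hb - g * U * u * hc

lemma sums_eq_zero {a0 a1 a2 a3 a4 a5 A0 A1 A2 A3 A4 A5 g0 g1 g2 g3 g4 g5 e f : K}
    (hu0 : a1 - a0 ≠ 0)
    (hu1 : a2 - a1 ≠ 0)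
    (hu2 : a3 - a2 ≠ 0)
    (hu3 : a4 - a3 ≠ 0)
    (hu4 : a5 - a4 ≠ 0)
    (hu5 : a0 - a5 ≠ 0)
    (hg0 : g0 * (a0 - a5) * (a1 - a0) * (A0 - A5) = 1)
    (hg1 : g1 * (a1 - a0) * (a2 - a1) * (A1 - A0) = 1)
    (hg2 : g2 * (a2 - a1) * (a3 - a2) * (A2 - A1) = 1)
    (hg3 : g3 * (a3 - a2) * (a4 - a3) * (A3 - A2) = 1)
    (hg4 : g4 * (a4 - a3) * (a5 - a4) * (A4 - A3) = 1)
    (hg5 : g5 * (a5 - a4) * (a0 - a5) * (A5 - A4) = 1)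
    (hc0 : (f - e * a0) = g0 * (a1 - a5))
    (hc1 : -(f - e * a1) = g1 * (a2 - a0))
    (hc2 : (f - e * a2) = g2 * (a3 - a1))
    (hc3 : -(f - e * a3) = g3 * (a4 - a2))
    (hc4 : (f - e * a4) = g4 * (a5 - a3))
    (hc5 : -(f - e * a5) = g5 * (a0 - a4))
    {t1 t2 : K} (ht1 : t1 =
      (A1 - A0) * a1 + (A2 - A1) * a2 + (A3 - A2) * a3 + (A4 - A3) * a4 + (A5 - A4) * a5 + (A0 -
      A5) * a0)
    (ht2 : t2 =
      (A1 - A0) * a1 ^ 2 + (A2 - A1) * a2 ^ 2 + (A3 - A2) * a3 ^ 2 + (A4 - A3) * a4 ^ 2 + (A5 -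
      A4) * a5 ^ 2 + (A0 - A5) * a0 ^ 2)
    (h : a2 ≠ a0) : t1 = 0 ∧ t2 = 0 := by
  have hb0 := mul_inv_cancel₀ hu0
  have hb1 := mul_inv_cancel₀ hu1
  have hb2 := mul_inv_cancel₀ hu2
  have hb3 := mul_inv_cancel₀ hu3
  have hb4 := mul_inv_cancel₀ hu4
  have hb5 := mul_inv_cancel₀ hu5
  have h0 := mul_add_mul_eq hb5 hb0 hg0
  have h1 := mul_add_mul_eq hb0 hb1 hg1
  have h2 := mul_add_mul_eq hb1 hb2 hg2
  have h3 := mul_add_mul_eq hb2 hb3 hg3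
  have h4 := mul_add_mul_eq hb3 hb4 hg4
  have h5 := mul_add_mul_eq hb4 hb5 hg5
  generalize (a1 - a0)⁻¹ = b0 at *
  generalize (a2 - a1)⁻¹ = b1 at *
  generalize (a3 - a2)⁻¹ = b2 at *
  generalize (a4 - a3)⁻¹ = b3 at *
  generalize (a5 - a4)⁻¹ = b4 at *
  generalize (a0 - a5)⁻¹ = b5 at *
  have k1 : -e * t1 = 0 := by
    rw [ht1]
    linear_combination
      ((A0 - A5) * hc0 + h0) - ((A1 - A0) * hc1 + h1) + ((A2 - A1) * hc2 + h2) - ((A3 - A2) * hc3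
      + h3) + ((A4 - A3) * hc4 + h4) - ((A5 - A4) * hc5 + h5)
  have k2 : f * t1 - e * t2 = 0 := by
    rw [ht1, ht2]
    linear_combination
      a0 * ((A0 - A5) * hc0 + h0) - hb0 - a1 * ((A1 - A0) * hc1 + h1) + hb1 + a2 * ((A2 - A1) *
      hc2 + h2) - hb2 - a3 * ((A3 - A2) * hc3 + h3) + hb3 + a4 * ((A4 - A3) * hc4 + h4) - hb4 -
      a5 * ((A5 - A4) * hc5 + h5) + hb5
  have k3 : e = 0 → f * t2 = 0 := by
    intro he
    subst he
    rw [ht2]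
    linear_combination
      a0 ^ 2 * ((A0 - A5) * hc0 + h0) - (a0 + a1) * hb0 - a1 ^ 2 * ((A1 - A0) * hc1 + h1) + (a1 +
      a2) * hb1 + a2 ^ 2 * ((A2 - A1) * hc2 + h2) - (a2 + a3) * hb2 - a3 ^ 2 * ((A3 - A2) * hc3 +
      h3) + (a3 + a4) * hb3 + a4 ^ 2 * ((A4 - A3) * hc4 + h4) - (a4 + a5) * hb4 - a5 ^ 2 * ((A5 -
      A4) * hc5 + h5) + (a5 + a0) * hb5
  by_cases he : e = 0
  · have hf : f ≠ 0 := by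
      rintro rfl
      have hz : g1 * (a2 - a0) = 0 := by rw [← hc1, he]; ring
      rcases mul_eq_zero.1 hz with hz | hz
      · rw [hz] at hg1
        simp at hg1
      · exact h (sub_eq_zero.1 hz)
    have h2 := (mul_eq_zero.1 (k3 he)).resolve_left hf
    rw [he] at k2
    exact ⟨(mul_eq_zero.1 (by linear_combination k2 : f * t1 = 0)).resolve_left hf, h2⟩
  · have h1 := (mul_eq_zero.1 k1).resolve_left (neg_ne_zero.2 he)
    rw [h1] at k2
    exact ⟨h1, (mul_eq_zero.1 (by linear_combination -k2 : e * t2 = 0)).resolve_left he⟩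

end

end ReeField

namespace ReeField

variable {K : Type*} [Field K]

lemma traces_eq_zero_of_collinear {d0 d1 d2 d3 d4 d5 a0 a1 a2 a3 a4 a5 A0 A1 A2 A3 A4 A5 e f : K}
    (hd0 : d0 ≠ 0) (hd1 : d1 ≠ 0) (hd2 : d2 ≠ 0) (hd3 : d3 ≠ 0) (hd4 : d4 ≠ 0) (hd5 : d5 ≠ 0)
    (hs0 : d1 = (A1 - A0) * (a1 - a0) * (a2 - a1) * d0 * d2)
    (hs1 : d2 = (A2 - A1) * (a2 - a1) * (a3 - a2) * d1 * d3)
    (hs2 : d3 = (A3 - A2) * (a3 - a2) * (a4 - a3) * d2 * d4)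
    (hs3 : d4 = (A4 - A3) * (a4 - a3) * (a5 - a4) * d3 * d5)
    (hs4 : d5 = (A5 - A4) * (a5 - a4) * (a0 - a5) * d4 * d0)
    (hs5 : d0 = (A0 - A5) * (a0 - a5) * (a1 - a0) * d5 * d1)
    (hc : ReeCollinear d0 d1 d2 d3 d4 d5 e (a0 * d0) (a1 * d1) (a2 * d2) (a3 * d3) (a4 * d4)
      (a5 * d5) f)
    {t1 t2 : K} (ht1 : t1 = (A1 - A0) * a1 + (A2 - A1) * a2 + (A3 - A2) * a3 + (A4 - A3) * a4 + (A5 - A4) * a5 + (A0 - A5) * a0)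
    (ht2 : t2 = (A1 - A0) * a1 ^ 2 + (A2 - A1) * a2 ^ 2 + (A3 - A2) * a3 ^ 2 + (A4 - A3) * a4 ^ 2 + (A5 - A4) * a5 ^ 2 + (A0 - A5) * a0 ^ 2)
    (h : a2 ≠ a0) : t1 = 0 ∧ t2 = 0 := by
  refine sums_eq_zero (g0 := d5 * d1 / d0) (g1 := d0 * d2 / d1) (g2 := d1 * d3 / d2) (g3 := d2 * d4 / d3) (g4 := d3 * d5 / d4) (g5 := d4 * d0 / d5) (e := e) (f := f)
     ?_ ?_ ?_ ?_ ?_ ?_ ?_ ?_ ?_ ?_ ?_ ?_ ?_ ?_ ?_ ?_ ?_ ?_ ht1 ht2 h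
  · intro h0
    rw [h0] at hs0
    simp [hd1] at hs0
  · intro h0
    rw [h0] at hs1
    simp [hd2] at hs1
  · intro h0
    rw [h0] at hs2
    simp [hd3] at hs2
  · intro h0
    rw [h0] at hs3
    simp [hd4] at hs3
  · intro h0
    rw [h0] at hs4
    simp [hd5] at hs4
  · intro h0
    rw [h0] at hs5
    simp [hd0] at hs5
  · rw [div_mul_eq_mul_div, div_mul_eq_mul_div, div_mul_eq_mul_div, div_eq_one_iff_eq hd0]
    linear_combination -hs5
  · rw [div_mul_eq_mul_div, div_mul_eq_mul_div, div_mul_eq_mul_div, div_eq_one_iff_eq hd1]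
    linear_combination -hs0
  · rw [div_mul_eq_mul_div, div_mul_eq_mul_div, div_mul_eq_mul_div, div_eq_one_iff_eq hd2]
    linear_combination -hs1
  · rw [div_mul_eq_mul_div, div_mul_eq_mul_div, div_mul_eq_mul_div, div_eq_one_iff_eq hd3]
    linear_combination -hs2
  · rw [div_mul_eq_mul_div, div_mul_eq_mul_div, div_mul_eq_mul_div, div_eq_one_iff_eq hd4]
    linear_combination -hs3
  · rw [div_mul_eq_mul_div, div_mul_eq_mul_div, div_mul_eq_mul_div, div_eq_one_iff_eq hd5]
    linear_combination -hs4
  · rw [div_mul_eq_mul_div, eq_div_iff hd0]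
    linear_combination -hc.c0
  · rw [div_mul_eq_mul_div, eq_div_iff hd1]
    linear_combination -hc.c1
  · rw [div_mul_eq_mul_div, eq_div_iff hd2]
    linear_combination -hc.c2
  · rw [div_mul_eq_mul_div, eq_div_iff hd3]
    linear_combination -hc.c3
  · rw [div_mul_eq_mul_div, eq_div_iff hd4]
    linear_combination -hc.c4
  · rw [div_mul_eq_mul_div, eq_div_iff hd5]
    linear_combination -hc.c5

variable (R : ReeField K)

/-- The trace to the fixed field of `φ`. -/
def tr (x : K) : K := x + R.φ x + R.φ (R.φ x) + R.φ (R.φ (R.φ x)) + R.φ (R.φ (R.φ (R.φ x)))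
  + R.φ (R.φ (R.φ (R.φ (R.φ x))))

lemma tr_φ (x : K) : R.tr (R.φ x) = R.tr x := by
  simp only [tr, R.φ_six]
  ring

lemma tr_sub (x y : K) : R.tr (x - y) = R.tr x - R.tr y := by
  simp only [tr, map_sub]
  ring

lemma tr_φ_sub (x : K) : R.tr (R.φ x - x) = 0 := by
  rw [tr_sub, tr_φ, sub_self]

lemma σ_tr (x : K) : R.σ (R.tr x) = R.tr (R.σ x) := by
  simp only [tr, map_add, R.σ_φ]

/-- The first coordinates of the loops, that is, the inverses of the last coordinates of the
points of the curve. -/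
def IsAdmissible (δ : K) : Prop := δ ≠ 0 ∧ ∃ a, R.σ δ = (R.φ a - a) * (δ * R.φ δ) ∧
  R.tr ((R.φ (R.σ a) - R.σ a) * R.φ a) = 0 ∧ R.tr ((R.φ (R.σ a) - R.σ a) * R.φ a ^ 2) = 0

lemma φ_eq_of_σ {δ a : K} (hδ : δ ≠ 0) (h : R.σ δ = (R.φ a - a) * (δ * R.φ δ)) :
    R.φ δ = (R.φ (R.σ a) - R.σ a) * (R.φ a - a) * (R.φ (R.φ a) - R.φ a) * δ * R.φ (R.φ δ) := by
  have h1 := congrArg R.σ h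
  simp only [map_mul, map_sub, R.σ_φ, R.σ_σ] at h1
  simp only [h, map_mul, map_sub] at h1
  have h3 : R.φ δ ≠ 0 := by simpa using hδ
  apply mul_left_cancel₀ (pow_ne_zero 2 h3)
  linear_combination h1

lemma isAdmissible_of_ζ_eq [CharP K 3] {X Y : R.V} (hX : X.1.1 ≠ 0) (h : R.cr X Y = 0)
    (hz : R.ζ X Y = X) : R.IsAdmissible X.1.1 := by
  have hc := R.collinear h
  have hs := R.σ_ζ_fst h
  rw [hz, pr] at hs
  obtain ⟨a, ha⟩ : ∃ a, Y.1.1 = a * X.1.1 := ⟨Y.1.1 / X.1.1, by field_simp⟩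
  rw [ha] at hs hc
  have hσ : R.σ X.1.1 = (R.φ a - a) * (X.1.1 * R.φ X.1.1) := by
    rw [hs, map_mul]; ring
  refine ⟨hX, a, hσ, ?_⟩
  have h0 := R.φ_eq_of_σ hX hσ
  have h1 := congrArg R.φ h0
  simp only [map_mul, map_sub] at h1
  have h2 := congrArg R.φ h1
  simp only [map_mul, map_sub] at h2
  have h3 := congrArg R.φ h2
  simp only [map_mul, map_sub] at h3
  have h4 := congrArg R.φ h3
  simp only [map_mul, map_sub, R.φ_six] at h4
  have h5 := congrArg R.φ h4
  simp only [map_mul, map_sub, R.φ_six] at h5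
  by_cases ha2 : R.φ (R.φ a) = a
  · have hA2 : R.φ (R.φ (R.σ a)) = R.σ a := by rw [← R.σ_φ, ← R.σ_φ, ha2]
    simp only [tr, map_mul, map_sub, map_pow, ha2, hA2]
    constructor
    · linear_combination (R.φ (R.σ a) - R.σ a) * (R.φ a - a) * three_eq_zero K
    · linear_combination (R.φ (R.σ a) - R.σ a) * (R.φ a ^ 2 - a ^ 2) * three_eq_zero K
  · simp only [map_mul] at hc
    exact traces_eq_zero_of_collinear hX (by simpa using hX) (by simpa using hX) (by simpa using hX)
      (by simpa using hX) (by simpa using hX) h0 h1 h2 h3 h4 h5 hc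
      (by simp only [tr, map_mul, map_sub, R.φ_six])
      (by simp only [tr, map_mul, map_sub, map_pow, R.φ_six]) ha2

end ReeField

namespace ReeField

variable {K : Type*} [Field K]

lemma coefficient_add_eq_zero [CharP K 3] {a0 a1 a2 a3 a4 a5 A0 A1 A2 A3 A4 A5 g0 g1 g2 : K}
    (h1 : (A1 - A0) * a1 + (A2 - A1) * a2 + (A3 - A2) * a3 + (A4 - A3) * a4 + (A5 - A4) * a5 +
      (A0 - A5) * a0 = 0)
    (h2 : (A1 - A0) * a1 ^ 2 + (A2 - A1) * a2 ^ 2 + (A3 - A2) * a3 ^ 2 + (A4 - A3) * a4 ^ 2 +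
      (A5 - A4) * a5 ^ 2 + (A0 - A5) * a0 ^ 2 = 0)
    (h3 : (A1 - A0) * a1 ^ 3 + (A2 - A1) * a2 ^ 3 + (A3 - A2) * a3 ^ 3 + (A4 - A3) * a4 ^ 3 +
      (A5 - A4) * a5 ^ 3 + (A0 - A5) * a0 ^ 3 = 0)
    (hS : a1 ^ 3 * (A1 ^ 2 - A0 ^ 2) + a2 ^ 3 * (A2 ^ 2 - A1 ^ 2) + a3 ^ 3 * (A3 ^ 2 - A2 ^ 2) +
      a4 ^ 3 * (A4 ^ 2 - A3 ^ 2) + a5 ^ 3 * (A5 ^ 2 - A4 ^ 2) + a0 ^ 3 * (A0 ^ 2 - A5 ^ 2) = 0)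
    (hg0 : g0 * (a0 - a5) * (a1 - a0) * (A0 - A5) = 1)
    (hg1 : g1 * (a1 - a0) * (a2 - a1) * (A1 - A0) = 1)
    (hg2 : g2 * (a2 - a1) * (a3 - a2) * (A2 - A1) = 1) :
    (g0 * (a1 - a5) + g1 * (a2 - a0)) * (a2 - a1)
      + (g1 * (a2 - a0) + g2 * (a3 - a1)) * (a1 - a0) = 0 := by
  have hE := coefficient_identity h1 h2 h3 hS
  clear h1 h2 h3 hS
  have h0' : (a0 - a5) * (a1 - a0) * (A0 - A5) ≠ 0 := fun h => by
    rw [mul_assoc, mul_assoc, ← mul_assoc (a0 - a5), h, mul_zero] at hg0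
    exact zero_ne_one hg0
  have h1' : (A1 - A0) ≠ 0 := fun h => by simp [h] at hg1
  have h2' : (a2 - a1) * (a3 - a2) * (A2 - A1) ≠ 0 := fun h => by
    rw [mul_assoc, mul_assoc, ← mul_assoc (a2 - a1), h, mul_zero] at hg2
    exact zero_ne_one hg2
  apply (mul_eq_zero.1 (?_ : ((a0 - a5) * (a1 - a0) * (A0 - A5)) * (A1 - A0) *
    ((a2 - a1) * (a3 - a2) * (A2 - A1)) * _ = 0)).resolve_left (mul_ne_zero (mul_ne_zero h0' h1') h2')
  linear_combination hE
    + (a1 - a5) * (a2 - a1) * (A1 - A0) * ((a2 - a1) * (a3 - a2) * (A2 - A1)) * hg0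
    + (a2 - a0) * (a2 - a0) * (a0 - a5) * (A0 - A5) * (a3 - a2) * (A2 - A1) * hg1
    + (a3 - a1) * (a1 - a0) * ((a0 - a5) * (a1 - a0) * (A0 - A5)) * (A1 - A0) * hg2

variable (R : ReeField K)

/-- The ratio of the conjugates of `δ` occurring in the equations of a line. -/
def ratio (δ : K) : K := R.φ (R.φ (R.φ (R.φ (R.φ δ)))) * R.φ δ / δ

lemma cr_fst_eq {X Y : R.V} {a : K} (hX : X.1.1 ≠ 0) (ha : Y.1.1 = X.1.1 * a) :
    (R.cr X Y).1.1 = X.1.1 * (R.ratio X.1.1 * (R.φ a - R.φ (R.φ (R.φ (R.φ (R.φ a)))))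
      + X.1.2 * a - Y.1.2) := by
  rw [cr_fst, ha, ratio]
  simp only [map_mul]
  field_simp

lemma snd_mul_sub {X Y : R.V} {a : K} (hX : X.1.1 ≠ 0) (ha : Y.1.1 = X.1.1 * a)
    (h : (R.cr X Y).1.1 = 0) :
    X.1.2 * (R.φ a - a) = R.ratio X.1.1 * (R.φ a - R.φ (R.φ (R.φ (R.φ (R.φ a)))))
      + R.φ (R.ratio X.1.1) * (R.φ (R.φ a) - a) := by
  rw [R.cr_fst_eq hX ha] at h
  have h1 := (mul_eq_zero.1 h).resolve_left hX
  have h2 := congrArg R.φ h1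
  simp only [map_mul, map_sub, map_add, R.φ_six, R.φ_snd, map_zero] at h2
  linear_combination -h1 - h2

lemma isotropic_or [CharP K 3] {X Y : R.V} {a : K} (hX : X.1.1 ≠ 0) (ha : Y.1.1 = X.1.1 * a)
    (h : (R.cr X Y).1.1 = 0) :
    (R.B X X = 0 → R.cr X Y = 0) ∧ (R.B X X ≠ 0 → R.φ (R.φ a) = a) := by
  have h1 := congrArg (fun Z : R.V => Z.1.1) (R.cr_cr X X Y)
  have h0 : (R.cr X (R.cr X Y)).1.1 = -((R.cr X Y).1.2 * X.1.1) := by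
    rw [cr_fst, h]
    simp
  simp only [add_fst, sub_fst, neg_fst, smul_fst, h0, ha] at h1
  have h2 : (R.cr X Y).1.2 = R.B X Y - R.B X X * a := by
    apply mul_left_cancel₀ hX
    linear_combination h1 + X.1.1 * ((R.cr X Y).1.2 - R.B X Y) * three_eq_zero K
  have h3 := congrArg R.φ h2
  rw [R.φ_snd, h2, map_sub, map_mul, φ_k, φ_k] at h3
  constructor
  · intro hB
    apply R.V_ext h
    rw [hB] at h2 h3
    rw [zero_snd, h2, ZeroMemClass.coe_zero] at *
    linear_combination h3 + R.B X Y * three_eq_zero K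
  · intro hB
    have hB' : (R.B X X : K) ≠ 0 := by simpa using hB
    have h4 := congrArg R.φ h3
    simp only [map_neg, map_sub, map_mul, φ_k] at h4
    apply mul_left_cancel₀ hB'
    linear_combination h4 - h3

lemma ζ_fst_of_σ [CharP K 3] {X Y : R.V} {a c : K} (ha : Y.1.1 = X.1.1 * a) (h : R.cr X Y = 0)
    (hc : R.σ c = (R.φ a - a) * (X.1.1 * R.φ X.1.1)) : (R.ζ X Y).1.1 = c := by
  apply R.σ.injective
  rw [R.σ_ζ_fst h, hc, pr, ha, map_mul]
  ring

/-- The sum of products of opposite conjugates vanishes when `a` is fixed by `φ²`. -/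
lemma sum_opposite_eq_zero [CharP K 3] {d0 d1 d2 d3 d4 d5 w : K}
    (h1 : d1 = -w * d0 * d2) (h2 : d2 = w * d1 * d3) (h3 : d3 = -w * d2 * d4)
    (h4 : d4 = w * d3 * d5) (hd1 : d1 ≠ 0) (hd2 : d2 ≠ 0) (hd3 : d3 ≠ 0) :
    d0 * d3 + d1 * d4 + d2 * d5 = 0 := by
  have hw : w ≠ 0 := by
    rintro rfl
    exact hd1 (by rw [h1]; ring)
  have k1 : -w ^ 2 * (d0 * d3) = 1 := by
    apply mul_left_cancel₀ hd1
    linear_combination -h1 + w * d0 * h2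
  have k2 : -w ^ 2 * (d1 * d4) = 1 := by
    apply mul_left_cancel₀ hd2
    linear_combination -h2 - w * d1 * h3
  have k3 : -w ^ 2 * (d2 * d5) = 1 := by
    apply mul_left_cancel₀ hd3
    linear_combination -h3 + w * d2 * h4
  apply mul_left_cancel₀ (neg_ne_zero.2 (pow_ne_zero 2 hw))
  linear_combination k1 + k2 + k3 + three_eq_zero K

theorem IsAdmissible.exists_ζ_eq [CharP K 3] {δ : K} (hδ : R.IsAdmissible δ)
    (h90 : ∀ c, R.tr c = 0 → ∃ b, R.φ b - b = c) :
    ∃ X Y : R.V, X.1.1 = δ ∧ R.cr X Y = 0 ∧ R.ζ X Y = X := by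
  obtain ⟨hδ, a, hσ, hT1, hT2⟩ := hδ
  have hφδ : R.φ δ ≠ 0 := by simpa using hδ
  have hu : R.φ a - a ≠ 0 := fun h => by
    rw [h, zero_mul] at hσ
    exact hδ (by simpa using hσ)
  have hs0 := R.φ_eq_of_σ hδ hσ
  have hs1 := congrArg R.φ hs0
  have hs2 := congrArg R.φ hs1
  have hs3 := congrArg R.φ hs2
  have hs4 := congrArg R.φ hs3
  have hs5 := congrArg R.φ hs4
  simp only [map_mul, map_sub, R.φ_six] at hs1 hs2 hs3 hs4 hs5
  have hA : R.tr (R.σ a * (R.φ a - a)) = 0 := by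
    simp only [tr, map_mul, map_sub, R.φ_six] at hT1 ⊢
    linear_combination -hT1
  have hT3 := congrArg R.σ hA
  have hS := congrArg R.σ hT2
  simp only [tr, map_mul, map_sub, map_add, map_pow, map_zero, R.φ_six, R.σ_φ, R.σ_σ] at hT3 hS
  obtain ⟨b, hb⟩ := h90 _ hA
  set g := R.ratio δ with hg
  have hg0 : g * (a - R.φ (R.φ (R.φ (R.φ (R.φ a))))) * (R.φ a - a)
      * (R.σ a - R.φ (R.φ (R.φ (R.φ (R.φ (R.σ a)))))) = 1 := by
    rw [hg, ratio, div_mul_eq_mul_div, div_mul_eq_mul_div, div_mul_eq_mul_div, div_eq_one_iff_eq hδ]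
    linear_combination -hs5
  have hg1 := congrArg R.φ hg0
  have hg2 := congrArg R.φ hg1
  simp only [map_mul, map_sub, map_one, R.φ_six] at hg1 hg2
  have hE := coefficient_add_eq_zero (by simpa only [tr, map_mul, map_sub, R.φ_six] using hT1)
    (by simpa only [tr, map_mul, map_sub, map_pow, R.φ_six] using hT2)
    (by linear_combination hT3) (by linear_combination -hS) hg0 hg1 hg2
  set G := g * (R.φ a - R.φ (R.φ (R.φ (R.φ (R.φ a))))) with hG
  have hφG : R.φ G = R.φ g * (R.φ (R.φ a) - a) := by
    rw [hG, map_mul, map_sub, R.φ_six]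
  obtain ⟨e, he⟩ : ∃ e, e * (R.φ a - a) = G + R.φ G := ⟨(G + R.φ G) / (R.φ a - a), by field_simp⟩
  have hφe : R.φ e = -e := by
    have hu1 : R.φ (R.φ a) - R.φ a ≠ 0 := by
      have := (map_ne_zero R.φ).2 hu
      rwa [map_sub] at this
    have h1 := congrArg R.φ he
    simp only [map_mul, map_sub, map_add] at h1
    apply mul_left_cancel₀ (mul_ne_zero hu hu1)
    rw [hφG] at h1 he
    simp only [map_mul, map_sub] at h1
    linear_combination (R.φ a - a) * h1 + (R.φ (R.φ a) - R.φ a) * he + hE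
  let X : R.V := ⟨(δ, e), hφe⟩
  let Y : R.V := ⟨(δ * a, e * a + G), by
    change R.φ (e * a + G) = -(e * a + G)
    rw [map_add, map_mul, hφe]
    linear_combination -he⟩
  have hX : X ≠ 0 := fun h => hδ (congrArg (fun Z : R.V => Z.1.1) h)
  have hXY1 : (R.cr X Y).1.1 = 0 := by
    rw [R.cr_fst_eq (X := X) (Y := Y) (a := a) hδ rfl]
    change δ * (G + e * a - (e * a + G)) = 0
    ring
  obtain ⟨hcr, ha2⟩ := R.isotropic_or (X := X) (Y := Y) (a := a) hδ rfl hXY1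
  have hXX : R.B X X = 0 := by
    by_contra hB
    replace ha2 := ha2 hB
    have hA2 : R.φ (R.φ (R.σ a)) = R.σ a := by rw [← R.σ_φ, ← R.σ_φ, ha2]
    have hG0 : G = 0 := by rw [hG, ha2, ha2]; ring
    have he0 : e = 0 := by
      rw [hG0, map_zero, add_zero] at he
      exact (mul_eq_zero.1 he).resolve_right hu
    apply hB
    apply Subtype.ext
    rw [coe_B, ZeroMemClass.coe_zero]
    change δ * R.φ (R.φ (R.φ δ)) + R.φ δ * R.φ (R.φ (R.φ (R.φ δ)))
      + R.φ (R.φ δ) * R.φ (R.φ (R.φ (R.φ (R.φ δ)))) + R.φ (R.φ (R.φ δ)) * δ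
      + R.φ (R.φ (R.φ (R.φ δ))) * R.φ δ + R.φ (R.φ (R.φ (R.φ (R.φ δ)))) * R.φ (R.φ δ) + e * e = 0
    simp only [ha2, hA2] at hs0 hs1 hs2 hs3
    have hQ := sum_opposite_eq_zero (d0 := δ) (d1 := R.φ δ) (d2 := R.φ (R.φ δ))
      (d3 := R.φ (R.φ (R.φ δ))) (d4 := R.φ (R.φ (R.φ (R.φ δ))))
      (d5 := R.φ (R.φ (R.φ (R.φ (R.φ δ))))) (w := (R.φ (R.σ a) - R.σ a) * (R.φ a - a) ^ 2)
      (by linear_combination hs0) (by linear_combination hs1) (by linear_combination hs2)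
      (by linear_combination hs3) hφδ (by simpa using hδ) (by simpa using hδ)
    rw [he0]
    linear_combination 2 * hQ
  replace hcr := hcr hXX
  let Z : R.V := ⟨(δ * b, e * b + g * (R.φ b - R.φ (R.φ (R.φ (R.φ (R.φ b)))))), by
    have h5 := congrArg (fun x => R.φ (R.φ (R.φ (R.φ (R.φ x))))) hb
    have h1 := congrArg R.φ hb
    simp only [map_mul, map_sub, R.φ_six] at h5 h1
    change R.φ (e * b + g * (R.φ b - R.φ (R.φ (R.φ (R.φ (R.φ b))))))
      = -(e * b + g * (R.φ b - R.φ (R.φ (R.φ (R.φ (R.φ b))))))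
    simp only [map_add, map_mul, map_sub, R.φ_six]
    rw [hφe]
    rw [hφG, hG] at he
    apply mul_left_cancel₀ hu
    linear_combination (-e * (R.φ a - a)) * hb + (R.φ a - a) * g * (h5 + hb)
      + (R.φ a - a) * R.φ g * (h1 + hb) - R.σ a * (R.φ a - a) * he + hg1 - hg0⟩
  have hXZ1 : (R.cr X Z).1.1 = 0 := by
    rw [R.cr_fst_eq (X := X) (Y := Z) (a := b) hδ rfl]
    change δ * (g * (R.φ b - R.φ (R.φ (R.φ (R.φ (R.φ b))))) + e * b - (e * b + g *
      (R.φ b - R.φ (R.φ (R.φ (R.φ (R.φ b))))))) = 0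
    ring
  have hcr' := (R.isotropic_or (X := X) (Y := Z) (a := b) hδ rfl hXZ1).1 hXX
  have hP : (R.ζ X Y).1.1 = δ := R.ζ_fst_of_σ (a := a) rfl hcr hσ
  have hP' : (R.ζ X Z).1.1 = δ * a := R.ζ_fst_of_σ (a := b) rfl hcr' (by
    rw [map_mul, hσ, hb]
    change _ = _ * (δ * R.φ δ)
    ring)
  have hPP := R.cr_ζ_ζ_of_isotropic hX hXX hcr hcr'
  have he' := R.snd_mul_sub (X := R.ζ X Y) (Y := R.ζ X Z) (a := a) (by rwa [hP]) (by rw [hP, hP']) (by rw [hPP, zero_fst])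
  refine ⟨X, Y, rfl, hcr, R.V_ext hP ?_⟩
  apply mul_right_cancel₀ hu
  rw [he', hP, ← hg, ← hφG, ← hG]
  exact he.symm

lemma snd_eq_of_ζ_eq [CharP K 3] {X Y X' Y' : R.V} (hX : X.1.1 ≠ 0) (h : R.cr X Y = 0)
    (hz : R.ζ X Y = X) (h' : R.cr X' Y' = 0) (hz' : R.ζ X' Y' = X') (hXX : X.1.1 = X'.1.1) :
    X = X' := by
  have hX' : X'.1.1 ≠ 0 := hXX ▸ hX
  obtain ⟨a, ha⟩ : ∃ a, Y.1.1 = X.1.1 * a := ⟨Y.1.1 / X.1.1, by field_simp⟩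
  obtain ⟨a', ha'⟩ : ∃ a, Y'.1.1 = X'.1.1 * a := ⟨Y'.1.1 / X'.1.1, by field_simp⟩
  have h1 := R.σ_ζ_fst h
  have h1' := R.σ_ζ_fst h'
  rw [hz, pr, ha, map_mul] at h1
  rw [hz', pr, ha', map_mul, ← hXX] at h1'
  have hφ : R.φ X.1.1 ≠ 0 := by simpa using hX
  have hu : R.φ a - a = R.φ a' - a' := by
    apply mul_left_cancel₀ (mul_ne_zero hX hφ)
    linear_combination h1' - h1
  have hu0 : R.φ a - a ≠ 0 := fun h0 => hX (by
    have : R.σ X.1.1 = 0 := by rw [h1]; linear_combination X.1.1 * R.φ X.1.1 * h0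
    simpa using this)
  have hc := R.snd_mul_sub hX ha (by rw [h, zero_fst])
  have hc' := R.snd_mul_sub hX' ha' (by rw [h', zero_fst])
  have hu1 := congrArg R.φ hu
  have hu5 := congrArg (fun x => R.φ (R.φ (R.φ (R.φ (R.φ x))))) hu
  simp only [map_sub, R.φ_six] at hu1 hu5
  apply R.V_ext hXX
  apply mul_right_cancel₀ hu0
  rw [← hXX, ← hu] at hc'
  linear_combination hc - hc' + R.ratio X.1.1 * (hu + hu5) + R.φ (R.ratio X.1.1) * (hu + hu1)

end ReeField

namespace ReeField

section Count

variable {K : Type*} [Field K] [Fintype K] [CharP K 3] {q : ℕ} (R : ReeField K)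

omit [CharP K 3] in
lemma card_fiber (hK : Fintype.card K = q ^ 6) (hq : 1 < q) (hφ : ∀ x, R.φ x = x ^ q) {c : K}
    (hc : R.tr c = 0) : Nat.card {x : K // R.φ x - x = c} = q := by
  classical
  rw [Nat.card_eq_fintype_card, Fintype.card_subtype]
  exact card_sub_fiber hK hq hφ R.φ_six hc

omit [CharP K 3] in
lemma exists_φ_sub_eq (hK : Fintype.card K = q ^ 6) (hq : 1 < q) (hφ : ∀ x, R.φ x = x ^ q) {c : K}
    (hc : R.tr c = 0) : ∃ x, R.φ x - x = c := by
  have h := R.card_fiber hK hq hφ hc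
  obtain ⟨x⟩ := (Nat.card_pos_iff.1 (by omega : 0 < Nat.card {x : K // R.φ x - x = c})).1
  exact ⟨x.1, x.2⟩

theorem card_isAdmissible (hK : Fintype.card K = q ^ 6) (hq : 1 < q) (hφ : ∀ x, R.φ x = x ^ q) :
    Nat.card {δ : K // R.IsAdmissible δ} = (q - 1) * (q ^ 3 + 1) := by
  have h7 : 7 ≤ Module.finrank R.k R.V := (R.finrank_V hK hq hφ).ge
  rw [← R.card_isLoop hK hq hφ h7]
  symm
  have hne {X : R.V} (hX : (R.hexagon h7).IsLoop X) : X.1.1 ≠ 0 := R.fst_ne_zero hX.1 hX.B_self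
  refine Nat.card_congr (Equiv.ofBijective
    (fun X : {X : R.V // (R.hexagon h7).IsLoop X} => (⟨X.1.1.1, ?_⟩ : {δ // R.IsAdmissible δ}))
    ⟨?_, ?_⟩)
  · obtain ⟨_, Y, h, hz⟩ := X.2
    exact R.isAdmissible_of_ζ_eq (hne X.2) h hz
  · rintro ⟨X, hX⟩ ⟨X', hX'⟩ hXX
    obtain ⟨_, Y, h, hz⟩ := id hX
    obtain ⟨_, Y', h', hz'⟩ := id hX'
    exact Subtype.ext (R.snd_eq_of_ζ_eq (hne hX) h hz h' hz' (Subtype.ext_iff.1 hXX))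
  · rintro ⟨δ, hδ⟩
    obtain ⟨X, Y, rfl, h, hz⟩ := hδ.exists_ζ_eq R fun c hc => R.exists_φ_sub_eq hK hq hφ hc
    exact ⟨⟨X, fun h0 => hδ.1 (by rw [h0, zero_fst]), Y, h, hz⟩, rfl⟩

omit [Fintype K] [CharP K 3] in
lemma traces_eq_zero_of_sub_eq {a a' : K} (h : R.φ a' - a' = R.φ a - a)
    (h1 : R.tr ((R.φ (R.σ a) - R.σ a) * R.φ a) = 0)
    (h2 : R.tr ((R.φ (R.σ a) - R.σ a) * R.φ a ^ 2) = 0) :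
    R.tr ((R.φ (R.σ a') - R.σ a') * R.φ a') = 0 ∧
      R.tr ((R.φ (R.σ a') - R.σ a') * R.φ a' ^ 2) = 0 := by
  obtain ⟨l, rfl⟩ : ∃ l, a' = a + l := ⟨a' - a, by ring⟩
  have hl : R.φ l = l := by
    rw [map_add] at h
    linear_combination h
  have h0 := R.tr_φ_sub (R.σ a)
  have hU : R.φ (R.σ (a + l)) - R.σ (a + l) = R.φ (R.σ a) - R.σ a := by
    rw [map_add, map_add, ← R.σ_φ l, hl]
    ring
  rw [hU, map_add, hl]
  simp only [tr, map_mul, map_sub, map_add, map_pow, R.φ_six, hl] at h0 h1 h2 ⊢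
  constructor
  · linear_combination h1 + l * h0
  · linear_combination h2 + 2 * l * h1 + l ^ 2 * h0

omit [CharP K 3] in
lemma nat_card_sigma_const {α : Type*} [Finite α] {β : α → Type*} [∀ a, Finite (β a)] {n : ℕ}
    (h : ∀ a, Nat.card (β a) = n) : Nat.card (Σ a, β a) = Nat.card α * n := by
  have := Fintype.ofFinite α
  rw [Nat.card_sigma, Finset.sum_congr rfl fun a _ => h a, Finset.sum_const, Finset.card_univ,
    Nat.card_eq_fintype_card, smul_eq_mul]

/-- The number of points of the curve with nonzero last coordinate. -/
theorem card_points (hK : Fintype.card K = q ^ 6) (hq : 1 < q) (hφ : ∀ x, R.φ x = x ^ q)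
    {q0 m : ℕ} (hσ : ∀ x, R.σ x = x ^ (3 * q0)) (hq0 : q = 3 * q0 ^ 2)
    (hm : m + 3 * q0 = q + 1) :
    Nat.card {t : K × K × K × K //
        R.φ t.2.1 - t.2.1 = t.1 ^ q0 * (R.φ t.1 - t.1)
        ∧ R.φ t.2.2.1 - t.2.2.1 = t.1 ^ (2 * q0) * (R.φ t.1 - t.1)
        ∧ t.2.2.2 ^ m = R.φ t.1 - t.1 ∧ t.2.2.2 ≠ 0} = (q - 1) * (q ^ 3 + 1) * q * (q * q) := by
  have hσ1 (a : K) : R.σ (a ^ q0) = R.φ a := by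
    rw [hσ, hφ, ← pow_mul, hq0]; ring_nf
  have hσ2 (a : K) : R.σ (a ^ (2 * q0)) = R.φ a ^ 2 := by
    rw [mul_comm, pow_mul, map_pow, hσ1]
  have ht1 (a : K) : R.tr (a ^ q0 * (R.φ a - a)) = 0 ↔
      R.tr ((R.φ (R.σ a) - R.σ a) * R.φ a) = 0 := by
    rw [← map_eq_zero R.σ, σ_tr, map_mul, hσ1, map_sub, R.σ_φ, mul_comm]
  have ht2 (a : K) : R.tr (a ^ (2 * q0) * (R.φ a - a)) = 0 ↔
      R.tr ((R.φ (R.σ a) - R.σ a) * R.φ a ^ 2) = 0 := by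
    rw [← map_eq_zero R.σ, σ_tr, map_mul, hσ2, map_sub, R.σ_φ, mul_comm]
  have hδ {a δ : K} (h : δ ≠ 0) :
      R.σ δ = (R.φ a - a) * (δ * R.φ δ) ↔ δ⁻¹ ^ m = R.φ a - a := by
    have hq' : δ * R.φ δ = δ ^ m * R.σ δ := by
      rw [hφ, hσ, ← pow_add, hm, pow_succ']
    have hs : R.σ δ ≠ 0 := by simpa using h
    rw [hq', inv_pow]
    constructor <;> intro h'
    · refine inv_eq_of_mul_eq_one_right (mul_right_cancel₀ hs ?_)
      linear_combination -h'
    · rw [← h', inv_mul_cancel_left₀ (pow_ne_zero m h)]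
  let P : Type _ := {p : K × K // p.2⁻¹ ^ m = R.φ p.1 - p.1 ∧ p.2 ≠ 0 ∧
    R.tr (p.1 ^ q0 * (R.φ p.1 - p.1)) = 0 ∧ R.tr (p.1 ^ (2 * q0) * (R.φ p.1 - p.1)) = 0}
  have hP : Nat.card P = (q - 1) * (q ^ 3 + 1) * q := by
    rw [← R.card_isAdmissible hK hq hφ, ← nat_card_sigma_const
      (β := fun δ : {δ // R.IsAdmissible δ} => {a : K // R.φ a - a = δ.1⁻¹ ^ m})]
    · exact Nat.card_congr
        { toFun := fun p => ⟨⟨p.1.2, p.2.2.1, p.1.1, (hδ p.2.2.1).2 p.2.1, (ht1 _).1 p.2.2.2.1,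
            (ht2 _).1 p.2.2.2.2⟩, p.1.1, p.2.1.symm⟩
          invFun := fun s => ⟨(s.2.1, s.1.1), s.2.2.symm, s.1.2.1, by
            obtain ⟨⟨δ, hδ0, a, h, h1, h2⟩, a', ha'⟩ := s
            have h' := R.traces_eq_zero_of_sub_eq (ha'.trans ((hδ hδ0).1 h)) h1 h2
            exact ⟨(ht1 a').2 h'.1, (ht2 a').2 h'.2⟩⟩
          left_inv := fun _ => rfl
          right_inv := fun _ => rfl }
    · rintro ⟨δ, hδ0, a, h, -⟩
      apply R.card_fiber hK hq hφ
      rw [(hδ hδ0).1 h, tr_φ_sub]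
  rw [← hP, ← nat_card_sigma_const
    (β := fun p : P => {b : K // R.φ b - b = p.1.1 ^ q0 * (R.φ p.1.1 - p.1.1)} ×
      {c : K // R.φ c - c = p.1.1 ^ (2 * q0) * (R.φ p.1.1 - p.1.1)})]
  · exact Nat.card_congr
      { toFun := fun t => ⟨⟨(t.1.1, t.1.2.2.2⁻¹), by rw [inv_inv]; exact t.2.2.2.1,
          inv_ne_zero t.2.2.2.2, by rw [← t.2.1, tr_φ_sub], by rw [← t.2.2.1, tr_φ_sub]⟩,
          ⟨t.1.2.1, t.2.1⟩, ⟨t.1.2.2.1, t.2.2.1⟩⟩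
        invFun := fun s => ⟨(s.1.1.1, s.2.1.1, s.2.2.1, s.1.1.2⁻¹), s.2.1.2, s.2.2.2, s.1.2.1,
          inv_ne_zero s.1.2.2.1⟩
        left_inv := fun t => by simp
        right_inv := fun s => by
          obtain ⟨⟨⟨a, δ⟩, h⟩, ⟨b, hb⟩, ⟨c, hc⟩⟩ := s
          simp }
  · intro p
    rw [Nat.card_prod, R.card_fiber hK hq hφ p.2.2.2.1, R.card_fiber hK hq hφ p.2.2.2.2]

end Count

end ReeField

/-- The field with `q ^ 6` elements, where `q = 3 ^ (2 * s + 1)`. -/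
noncomputable def ReeField.ofCard (s : ℕ) (F : Type*) [Field F] [Fintype F] [CharP F 3]
    (hF : Fintype.card F = (3 ^ (2 * s + 1)) ^ 6) : ReeField F where
  φ := iterateFrobenius F 3 (2 * s + 1)
  σ := iterateFrobenius F 3 (s + 1)
  τ := (iterateFrobeniusEquiv F 3 (s + 1)).symm
  φ_six x := by
    simp only [iterateFrobenius_def, ← pow_mul]
    rw [show 3 ^ (2 * s + 1) * 3 ^ (2 * s + 1) * 3 ^ (2 * s + 1) * 3 ^ (2 * s + 1) *
      3 ^ (2 * s + 1) * 3 ^ (2 * s + 1) = Fintype.card F by rw [hF]; ring, FiniteField.pow_card]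
  σ_φ x := by
    simp only [iterateFrobenius_def]
    rw [pow_right_comm]
  σ_σ x := by
    simp only [iterateFrobenius_def, ← pow_mul]
    congr 1
    ring
  σ_τ x := (iterateFrobeniusEquiv F 3 (s + 1)).apply_symm_apply x
  τ_σ x := (iterateFrobeniusEquiv F 3 (s + 1)).symm_apply_apply x

/-- For `q_0 = 3^s`, `q = 3 q_0²`, `m = q − 3q_0 + 1`, and `F_{q⁶}` the field with `q⁶`
elements, the number of quadruples `(a,b,c,d) ∈ F_{q⁶}⁴` with
`b^q − b = a^{q_0}(a^q − a)`, `c^q − c = a^{2q_0}(a^q − a)`, `d^m = a^q − a`, and `d ≠ 0`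
(the affine `F_{q⁶}`-points of Skabelund's cover `R̃_q` that are not `F_q`-rational)
equals `q⁷ − q⁶ + q⁴ − q³`. -/
theorem skabelund_ree_point_count (s : ℕ) (hs : 0 < s) (q0 q m : ℕ)
    (hq0 : q0 = 3 ^ s) (hq : q = 3 * q0 ^ 2) (hm : m = q - 3 * q0 + 1)
    (F : Type*) [Field F] [Fintype F] (hF : Fintype.card F = q ^ 6) :
    Nat.card {t : F × F × F × F //
        t.2.1 ^ q - t.2.1 = t.1 ^ q0 * (t.1 ^ q - t.1)
        ∧ t.2.2.1 ^ q - t.2.2.1 = t.1 ^ (2 * q0) * (t.1 ^ q - t.1)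
        ∧ t.2.2.2 ^ m = t.1 ^ q - t.1 ∧ t.2.2.2 ≠ 0}
      = q ^ 7 - q ^ 6 + q ^ 4 - q ^ 3 := by
  have hqs : q = 3 ^ (2 * s + 1) := by rw [hq, hq0]; ring
  have hp : CharP F 3 := charP_of_card_eq_prime_pow (f := (2 * s + 1) * 6) (by
    rw [hF, hqs, ← pow_mul])
  have h1 : 1 ≤ q0 := hq0 ▸ Nat.one_le_pow _ _ (by norm_num)
  have hqq : 3 * q0 ≤ q := by rw [hq]; nlinarith
  obtain ⟨R, hφ, hσ⟩ : ∃ R : ReeField F, (∀ x, R.φ x = x ^ q) ∧ ∀ x, R.σ x = x ^ (3 * q0) := by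
    refine ⟨ReeField.ofCard s F (by rw [hF, hqs]), fun x => ?_, fun x => ?_⟩
    · simp only [hqs]
      exact iterateFrobenius_def ..
    · rw [hq0, ← pow_succ']
      exact iterateFrobenius_def ..
  have key := R.card_points hF (by omega) hφ hσ hq (m := m) (by omega)
  simp only [hφ] at key
  rw [key]
  obtain ⟨n, rfl⟩ : ∃ n, q = n + 1 := ⟨q - 1, by omega⟩
  have h7 : (n + 1) ^ 7 - (n + 1) ^ 6 = n * (n + 1) ^ 6 := Nat.sub_eq_of_eq_add (by ring)
  rw [h7, Nat.add_sub_cancel, eq_comm]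
  exact Nat.sub_eq_of_eq_add (by ring)
end

section
/- Let F be a field, r ≥ 1 an integer, g ∈ F[X] a polynomial, and B ⊆ F a finite set with |B| = r + 1 on which g is constant (g(β) = g(β') for all β, β' ∈ B). Let f ∈ F[X] lie in the F-span of the polynomials X^i·g(X)^j with 0 ≤ i ≤ r − 1 and j ≥ 0. If α ∈ B and f vanishes at every point of B \ {α}, then f(α) = 0. Consequently, any two polynomials in this span that agree on B \ {α} take the same value at α, so B \ {α} is a recovery set of size r for the coordinate α in the corresponding evaluation code. -/
open Polynomial

/-- On a set where `g` is constant, a polynomial in the span of the `X ^ i * g ^ j` with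
`i ≤ r - 1` agrees with a polynomial of degree less than `r`. -/
theorem exists_degree_lt_eval_eq_of_mem_span {F : Type*} [Field F] {r : ℕ} (hr : 1 ≤ r)
    {g : F[X]} {B : Finset F} {c : F} (hg : ∀ β ∈ B, g.eval β = c) {f : F[X]}
    (hf : f ∈ Submodule.span F {p : F[X] | ∃ i j : ℕ, i ≤ r - 1 ∧ p = X ^ i * g ^ j}) :
    ∃ h : F[X], h.degree < r ∧ ∀ β ∈ B, f.eval β = h.eval β := by
  simp only [← mem_degreeLT]
  induction hf using Submodule.span_induction with
  | mem p hp =>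
    obtain ⟨i, j, hi, rfl⟩ := hp
    refine ⟨c ^ j • X ^ i, Submodule.smul_mem _ _ ?_, fun β hβ => ?_⟩
    · rw [mem_degreeLT, degree_X_pow]
      exact_mod_cast (by omega : i < r)
    · simp [hg β hβ, mul_comm]
  | zero => exact ⟨0, Submodule.zero_mem _, fun _ _ => rfl⟩
  | add p q _ _ hp hq =>
    obtain ⟨p', hp', hpe⟩ := hp
    obtain ⟨q', hq', hqe⟩ := hq
    exact ⟨p' + q', Submodule.add_mem _ hp' hq', fun β hβ => by
      simp [hpe β hβ, hqe β hβ]⟩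
  | smul a p _ hp =>
    obtain ⟨p', hp', hpe⟩ := hp
    exact ⟨a • p', Submodule.smul_mem _ _ hp', fun β hβ => by simp [hpe β hβ]⟩

/-- Tamo–Barg recovery: let `B ⊆ F` be a set of `r + 1` points on which the polynomial `g`
is constant, and let `f` lie in the span of the polynomials `X^i g^j` with `0 ≤ i ≤ r − 1`.
If `α ∈ B` and `f` vanishes on `B \ {α}`, then `f(α) = 0`. Consequently, any two
polynomials in this span agreeing on `B \ {α}` take the same value at `α`, and
`B \ {α}` is a recovery set of size `r` for the coordinate `α`. -/
theorem tamoBarg_recovery {F : Type*} [Field F] [DecidableEq F] {r : ℕ} (hr : 1 ≤ r)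
    (g : F[X]) (B : Finset F) (hB : B.card = r + 1)
    (hg : ∀ β ∈ B, ∀ β' ∈ B, g.eval β = g.eval β')
    (f : F[X])
    (hf : f ∈ Submodule.span F
      {p : F[X] | ∃ i j : ℕ, i ≤ r - 1 ∧ p = X ^ i * g ^ j})
    (α : F) (hα : α ∈ B)
    (hvanish : ∀ β ∈ B, β ≠ α → f.eval β = 0) :
    f.eval α = 0
    ∧ (∀ f1 ∈ Submodule.span F
          {p : F[X] | ∃ i j : ℕ, i ≤ r - 1 ∧ p = X ^ i * g ^ j},
        ∀ f2 ∈ Submodule.span F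
          {p : F[X] | ∃ i j : ℕ, i ≤ r - 1 ∧ p = X ^ i * g ^ j},
        (∀ β ∈ B, β ≠ α → f1.eval β = f2.eval β) → f1.eval α = f2.eval α)
    ∧ (B.erase α).card = r := by
  have hcard : (B.erase α).card = r := by simp [Finset.card_erase_of_mem hα, hB]
  have key : ∀ p ∈ Submodule.span F {p : F[X] | ∃ i j : ℕ, i ≤ r - 1 ∧ p = X ^ i * g ^ j},
      (∀ β ∈ B, β ≠ α → p.eval β = 0) → p.eval α = 0 := by
    intro p hp hv
    obtain ⟨h, hdeg, heq⟩ :=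
      exists_degree_lt_eval_eq_of_mem_span hr (fun β hβ => hg β hβ α hα) hp
    have h0 : h = 0 := by
      refine eq_zero_of_degree_lt_of_eval_finset_eq_zero (B.erase α) (by rwa [hcard]) ?_
      intro β hβ
      obtain ⟨hne, hmem⟩ := Finset.mem_erase.mp hβ
      rw [← heq β hmem, hv β hmem hne]
    rw [heq α hα, h0, eval_zero]
  refine ⟨key f hf hvanish, fun f1 h1 f2 h2 hagree => ?_, hcard⟩
  have hsub := key (f1 - f2) (Submodule.sub_mem _ h1 h2) fun β hβ hne => by
    rw [eval_sub, hagree β hβ hne, sub_self]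
  rwa [eval_sub, sub_eq_zero] at hsub
end
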